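/- arXiv:2012.15722 — 4 statements merged into one kernel-verified Lean document; each statement's English description precedes it below -/
import Mathlib

section
/- Let 0 < κ ≤ 1 and 0 < ε < κ/6, let G be a finite graph that is a κ-expander, and let H be a subgraph of G satisfying e(H) ≥ (1−ε)·e(G). Then there exists an induced subgraph H* of H such that e(H*) ≥ (1 − 6ε/κ)·e(G) and H* is a (κ/3)-expander. -/
/-- The number of edges of a graph. -/
noncomputable def edgeCount {V : Type*} (G : SimpleGraph V) : ℕ :=
  Nat.card G.edgeSet

/-- The degree of a vertex. -/
noncomputable def vdeg {V : Type*} (G : SimpleGraph V) (v : V) : ℕ :=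
  Nat.card (G.neighborSet v)

/-- The volume of a vertex set: the sum of the degrees of its vertices. -/
noncomputable def vol {V : Type*} (G : SimpleGraph V) (X : Set V) : ℕ :=
  ∑ᶠ v ∈ X, vdeg G v

/-- The number of edges with exactly one endpoint in `X` (counted via ordered pairs
`(x, y)` with `x ∈ X`, `y ∉ X`, `Adj x y`; each crossing edge gives exactly one such pair). -/
noncomputable def cut {V : Type*} (G : SimpleGraph V) (X : Set V) : ℕ :=
  Nat.card {p : V × V // p.1 ∈ X ∧ p.2 ∉ X ∧ G.Adj p.1 p.2}

/-- A graph is a `κ`-expander if every vertex set `X` satisfies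
`e(X, X̄) ≥ κ · min (vol X) (vol X̄)`. -/
def IsExpander {V : Type*} (G : SimpleGraph V) (κ : ℝ) : Prop :=
  ∀ X : Set V, κ * min (vol G X : ℝ) (vol G Xᶜ : ℝ) ≤ (cut G X : ℝ)

/-- number of ordered related pairs between two sets -/
noncomputable def pc {V : Type*} (A : V → V → Prop) (P Q : Set V) : ℕ :=
  Nat.card {p : V × V // p.1 ∈ P ∧ p.2 ∈ Q ∧ A p.1 p.2}

theorem pc_mono {V : Type*} [Finite V] {A B : V → V → Prop} {P Q P' Q' : Set V}
    (hAB : ∀ x ∈ P, ∀ y ∈ Q, A x y → B x y ∧ x ∈ P' ∧ y ∈ Q') : pc A P Q ≤ pc B P' Q' := by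
  refine Nat.card_le_card_of_injective
    (fun p => ⟨p.1, (hAB _ p.2.1 _ p.2.2.1 p.2.2.2).2.1, (hAB _ p.2.1 _ p.2.2.1 p.2.2.2).2.2,
      (hAB _ p.2.1 _ p.2.2.1 p.2.2.2).1⟩) ?_
  intro p q h
  simpa [Subtype.ext_iff] using h

theorem pc_symm {V : Type*} {A : V → V → Prop} (hA : ∀ x y, A x y → A y x) (P Q : Set V) :
    pc A P Q = pc A Q P :=
  Nat.card_congr
    { toFun := fun p => ⟨p.1.swap, p.2.2.1, p.2.1, hA _ _ p.2.2.2⟩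
      invFun := fun p => ⟨p.1.swap, p.2.2.1, p.2.1, hA _ _ p.2.2.2⟩
      left_inv := fun p => by simp
      right_inv := fun p => by simp }

theorem pc_union_left {V : Type*} [Finite V] (A : V → V → Prop) {P P' : Set V} (Q : Set V)
    (h : Disjoint P P') : pc A (P ∪ P') Q = pc A P Q + pc A P' Q := by
  have := Set.ncard_union_eq (s := {p : V × V | p.1 ∈ P ∧ p.2 ∈ Q ∧ A p.1 p.2})
    (t := {p : V × V | p.1 ∈ P' ∧ p.2 ∈ Q ∧ A p.1 p.2})
    (Set.disjoint_left.2 fun p hp hp' => Set.disjoint_left.1 h hp.1 hp'.1)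
  have e : {p : V × V | p.1 ∈ P ∪ P' ∧ p.2 ∈ Q ∧ A p.1 p.2} =
    {p : V × V | p.1 ∈ P ∧ p.2 ∈ Q ∧ A p.1 p.2} ∪ {p : V × V | p.1 ∈ P' ∧ p.2 ∈ Q ∧ A p.1 p.2} := by
    ext p; simp only [Set.mem_union, Set.mem_ofPred_eq]; tauto
  rw [← e] at this
  exact this

theorem pc_union_right {V : Type*} [Finite V] (A : V → V → Prop) (P : Set V) {Q Q' : Set V}
    (h : Disjoint Q Q') : pc A P (Q ∪ Q') = pc A P Q + pc A P Q' := by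
  have := Set.ncard_union_eq (s := {p : V × V | p.1 ∈ P ∧ p.2 ∈ Q ∧ A p.1 p.2})
    (t := {p : V × V | p.1 ∈ P ∧ p.2 ∈ Q' ∧ A p.1 p.2})
    (Set.disjoint_left.2 fun p hp hp' => Set.disjoint_left.1 h hp.2.1 hp'.2.1)
  have e : {p : V × V | p.1 ∈ P ∧ p.2 ∈ Q ∪ Q' ∧ A p.1 p.2} =
    {p : V × V | p.1 ∈ P ∧ p.2 ∈ Q ∧ A p.1 p.2} ∪ {p : V × V | p.1 ∈ P ∧ p.2 ∈ Q' ∧ A p.1 p.2} := by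
    ext p; simp only [Set.mem_union, Set.mem_ofPred_eq]; tauto
  rw [← e] at this
  exact this

theorem cut_eq_pc {V : Type*} (G : SimpleGraph V) (X : Set V) : cut G X = pc G.Adj X Xᶜ := rfl

theorem vol_eq_pc {V : Type*} [Finite V] (G : SimpleGraph V) (X : Set V) :
    vol G X = pc G.Adj X Set.univ := by
  classical
  have := Fintype.ofFinite V
  have e : {p : V × V // p.1 ∈ X ∧ p.2 ∈ (Set.univ : Set V) ∧ G.Adj p.1 p.2} ≃
      (Σ x : X, G.neighborSet x) :=
    { toFun := fun p => ⟨⟨p.1.1, p.2.1⟩, ⟨p.1.2, p.2.2.2⟩⟩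
      invFun := fun q => ⟨(q.1.1, q.2.1), q.1.2, trivial, q.2.2⟩
      left_inv := fun p => rfl
      right_inv := fun p => rfl }
  unfold vol pc vdeg
  rw [Nat.card_congr e, Nat.card_sigma, ← finsum_set_coe_eq_finsum_mem,
    finsum_eq_sum_of_fintype]

theorem edge_eq_pc {V : Type*} [Finite V] (G : SimpleGraph V) :
    2 * edgeCount G = pc G.Adj Set.univ Set.univ := by
  classical
  have := Fintype.ofFinite V
  have h := G.dart_card_eq_twice_card_edges
  have e : {p : V × V // p.1 ∈ (Set.univ : Set V) ∧ p.2 ∈ (Set.univ : Set V) ∧ G.Adj p.1 p.2} ≃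
      G.Dart :=
    { toFun := fun p => ⟨p.1, p.2.2.2⟩
      invFun := fun q => ⟨q.toProd, trivial, trivial, q.adj⟩
      left_inv := fun p => rfl
      right_inv := fun p => rfl }
  unfold pc edgeCount
  rw [Nat.card_congr e, Nat.card_eq_fintype_card, Nat.card_eq_fintype_card, h,
    SimpleGraph.edgeFinset_card]

theorem pc_transfer {W V : Type*} (B : W → W → Prop) (A : V → V → Prop)
    (φ : W → V) (hφ : Function.Injective φ) (h : ∀ x y, B x y ↔ A (φ x) (φ y)) (P Q : Set W) :
    pc B P Q = pc A (φ '' P) (φ '' Q) := by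
  refine Nat.card_congr (Equiv.ofBijective
    (fun p => ⟨(φ p.1.1, φ p.1.2), ⟨_, p.2.1, rfl⟩, ⟨_, p.2.2.1, rfl⟩, (h _ _).1 p.2.2.2⟩) ⟨?_, ?_⟩)
  · rintro ⟨⟨a, b⟩, _⟩ ⟨⟨c, d⟩, _⟩ hh
    simp only [Subtype.mk.injEq, Prod.mk.injEq] at hh ⊢
    exact ⟨hφ hh.1, hφ hh.2⟩
  · rintro ⟨⟨a, b⟩, ⟨x, hx, hxa⟩, ⟨y, hy, hyb⟩, hA⟩
    dsimp only at hxa hyb hA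
    subst hxa hyb
    exact ⟨⟨(x, y), hx, hy, (h _ _).2 hA⟩, rfl⟩

theorem bigcore {V : Type*} [Finite V] (κ ε : ℝ) (hκ0 : 0 < κ) (hκ1 : κ ≤ 1) (hε0 : 0 < ε)
    (hε : ε < κ / 6) (A G : V → V → Prop) (hA : ∀ x y, A x y → A y x)
    (hGs : ∀ x y, G x y → G y x) (hAG : ∀ x y, A x y → G x y) (m : ℝ)
    (hm : (pc G Set.univ Set.univ : ℝ) = 2 * m)
    (hG : ∀ X : Set V, κ * min (pc G X Set.univ : ℝ) (pc G Xᶜ Set.univ : ℝ) ≤ (pc G X Xᶜ : ℝ))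
    (he : (1 - ε) * (2 * m) ≤ (pc A Set.univ Set.univ : ℝ)) :
    ∃ U : Set V, (1 - 6 * ε / κ) * (2 * m) ≤ (pc A U U : ℝ) ∧
      ∀ X Y : Set V, Disjoint X Y → X ∪ Y = U →
        κ / 3 * min (pc A X U : ℝ) (pc A Y U : ℝ) ≤ (pc A X Y : ℝ) := by
  classical
  obtain ⟨d, rfl⟩ : ∃ d, ε = d * κ := ⟨ε / κ, by field_simp⟩
  have hd : d < 1 / 6 := by
    by_contra hh
    push Not at hh
    nlinarith
  have hd0 : 0 < d := pos_of_mul_pos_left hε0 hκ0.le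
  have hdk : d * κ ≤ d := by nlinarith
  have hm0 : 0 ≤ m := by
    have : (0 : ℝ) ≤ pc G Set.univ Set.univ := Nat.cast_nonneg _
    linarith
  have hle : ∀ P Q : Set V, (pc A P Q : ℝ) ≤ pc G P Q := fun P Q => by
    exact_mod_cast pc_mono fun x hx y hy h => ⟨hAG _ _ h, hx, hy⟩
  have symA : ∀ P Q : Set V, (pc A P Q : ℝ) = pc A Q P := fun P Q => by rw [pc_symm hA]
  have symG : ∀ P Q : Set V, (pc G P Q : ℝ) = pc G Q P := fun P Q => by rw [pc_symm hGs]
  have ul : ∀ (B : V → V → Prop) (P P' Q : Set V), Disjoint P P' →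
      (pc B (P ∪ P') Q : ℝ) = pc B P Q + pc B P' Q := fun B P P' Q h => by
    rw [pc_union_left B Q h]; push_cast; rfl
  have ur : ∀ (B : V → V → Prop) (P Q Q' : Set V), Disjoint Q Q' →
      (pc B P (Q ∪ Q') : ℝ) = pc B P Q + pc B P Q' := fun B P Q Q' h => by
    rw [pc_union_right B P h]; push_cast; rfl
  obtain ⟨R, hR⟩ := Set.Finite.exists_maximal
    (s := {R : Set V | (pc A R Rᶜ : ℝ) ≤ κ / 3 * pc A R Set.univ ∧ (pc G R Set.univ : ℝ) ≤ m})
    (Set.toFinite _) ⟨∅, by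
      have h1 : ∀ (B : V → V → Prop) (Q : Set V), pc B ∅ Q = 0 := fun B Q => by simp [pc]
      simp [h1, hm0]⟩
  obtain ⟨⟨hR1, hR2⟩, hRmax⟩ := hR
  have nn : ∀ (B : V → V → Prop) (P Q : Set V), (0 : ℝ) ≤ pc B P Q :=
    fun B P Q => Nat.cast_nonneg _
  have hcR : Disjoint R Rᶜ := disjoint_compl_right
  have huR : R ∪ Rᶜ = Set.univ := Set.union_compl_self R
  -- R is small
  have hRs : (pc G R Set.univ : ℝ) ≤ 3 / 2 * (d * m) := by
    have h1 := hG R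
    have e1 := ul G R Rᶜ Set.univ hcR
    have e2 := ur G R R Rᶜ hcR
    have e3 := ur G Rᶜ R Rᶜ hcR
    have e1' := ul A R Rᶜ Set.univ hcR
    have e2' := ur A R R Rᶜ hcR
    have e3' := ur A Rᶜ R Rᶜ hcR
    rw [huR] at e1 e2 e3 e1' e2' e3'
    rw [min_eq_left (by linarith)] at h1
    have s1 := symA Rᶜ R
    have s2 := symG Rᶜ R
    have l1 := hle R R
    have l2 := hle Rᶜ Rᶜ
    have l3 := hle R Set.univ
    have l4 := mul_le_mul_of_nonneg_left l3 hκ0.le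
    have : κ * (pc G R Set.univ : ℝ) ≤ κ * (3 / 2 * (d * m)) := by linarith
    exact le_of_mul_le_mul_left this hκ0
  have hUU : 2 * m - 5 * (d * m) ≤ (pc A Rᶜ Rᶜ : ℝ) := by
    have e1' := ul A R Rᶜ Set.univ hcR
    have e2' := ur A R R Rᶜ hcR
    have e3' := ur A Rᶜ R Rᶜ hcR
    rw [huR] at e1' e2' e3'
    have s1 := symA Rᶜ R
    have l3 := hle R Set.univ
    have := nn A R R
    have := mul_le_mul_of_nonneg_right hdk hm0
    linarith
  have key : ∀ X Y : Set V, Disjoint X Y → X ∪ Y = Rᶜ → (pc A X Rᶜ : ℝ) ≤ pc A Y Rᶜ →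
      (pc A X Y : ℝ) < κ / 3 * pc A X Rᶜ → False := by
    intro X Y hXY hU hlt hc
    have dRX : Disjoint R X := hcR.mono_right (hU ▸ Set.subset_union_left)
    have dRY : Disjoint R Y := hcR.mono_right (hU ▸ Set.subset_union_right)
    have hRXY : Disjoint (R ∪ X) Y := Set.disjoint_union_left.2 ⟨dRY, hXY⟩
    have hun : (R ∪ X) ∪ Y = Set.univ := by rw [Set.union_assoc, hU, huR]
    have hcomp : (R ∪ X)ᶜ = Y := by
      ext v
      have h1 : v ∈ (R ∪ X) ∪ Y := hun ▸ Set.mem_univ v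
      have h2 : v ∈ R ∪ X → v ∉ Y := fun h => Set.disjoint_left.1 hRXY h
      simp only [Set.mem_compl_iff]
      constructor
      · intro h; exact h1.resolve_left h
      · intro h h'; exact h2 h' h
    have full : ∀ (B : V → V → Prop) (P : Set V),
        (pc B P Set.univ : ℝ) = pc B P R + pc B P X + pc B P Y := fun B P => by
      rw [← hun, ur B P _ _ hRXY, ur B P _ _ dRX]
    have fullC : ∀ (B : V → V → Prop) (P : Set V),
        (pc B P Rᶜ : ℝ) = pc B P X + pc B P Y := fun B P => by
      rw [← hU, ur B P _ _ hXY]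
    have fullL : ∀ (B : V → V → Prop),
        (pc B Set.univ Set.univ : ℝ) = pc B R Set.univ + pc B X Set.univ + pc B Y Set.univ := by
      intro B
      have := ul B (R ∪ X) Y Set.univ hRXY
      rw [hun, ul B R X _ dRX] at this
      exact this
    have fUU : (pc A Rᶜ Rᶜ : ℝ) = pc A X Rᶜ + pc A Y Rᶜ := by
      have := ul A X Y Rᶜ hXY
      rwa [hU] at this
    have hXpos : (0 : ℝ) < pc A X Rᶜ := by
      have := nn A X Y
      by_contra hh
      have : κ / 3 * (pc A X Rᶜ : ℝ) ≤ 0 := mul_nonpos_of_nonneg_of_nonpos (by linarith) (by linarith)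
      linarith
    have fA := fullL A
    have fG := fullL G
    have a1 := full A R
    have a2 := full A X
    have a3 := full A Y
    have g1 := full G R
    have g2 := full G X
    have g3 := full G Y
    have c1 := fullC A R
    have c2 := fullC A X
    have c3 := fullC A Y
    have s1 := symA X R
    have s2 := symA Y R
    have s3 := symA Y X
    have t1 := symG X R
    have t2 := symG Y R
    have t3 := symG Y X
    have l1 := hle R R
    have l2 := hle R X
    have l3 := hle R Y
    have l4 := hle X X
    have l5 := hle X Y
    have l6 := hle Y Y
    have n1 := nn A R X
    have n2 := nn A R Y
    have n3 := nn A R R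
    have n4 := nn A X Y
    have kn : 0 ≤ κ / 3 * (pc A X R : ℝ) := mul_nonneg (by linarith) (nn _ _ _)
    have hbig : m < pc G R Set.univ + pc G X Set.univ := by
      by_contra hh
      push Not at hh
      have hsub : R ∪ X ≤ R := hRmax (y := R ∪ X) ⟨by
        rw [hcomp, ul A R X _ dRX, ul A R X _ dRX]
        have : (pc A X Set.univ : ℝ) = pc A X R + pc A X Rᶜ := by linarith
        rw [this]
        linarith, by
        rw [ul G R X _ dRX]; exact hh⟩ Set.subset_union_left
      have hX : X = ∅ := by
        ext v
        simp only [Set.mem_empty_iff_false, iff_false]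
        intro hv
        exact Set.disjoint_left.1 dRX (hsub (Or.inr hv)) hv
      subst hX
      simp [pc] at hXpos
    have hexp := hG (R ∪ X)
    rw [hcomp, ul G R X _ dRX, ul G R X _ dRX, min_eq_right (by linarith)] at hexp
    have hRG : κ * (pc A R Set.univ : ℝ) ≤ κ * (3 / 2 * (d * m)) :=
      mul_le_mul_of_nonneg_left ((hle _ _).trans hRs) hκ0.le
    have hXY' : κ * (pc A X Rᶜ : ℝ) ≤ κ * pc G Y Set.univ := by
      refine mul_le_mul_of_nonneg_left ?_ hκ0.le
      have := nn G R Y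
      linarith
    have hY : (pc G Y Set.univ : ℝ) ≤ 9 / 4 * (d * m) := by
      refine le_of_mul_le_mul_left (?_ : κ * _ ≤ κ * _) hκ0
      linarith
    have hmpos : 0 < m := by linarith
    have := mul_lt_mul_of_pos_right hd hmpos
    have := nn G R Y
    linarith
  refine ⟨Rᶜ, ?_, ?_⟩
  · have : 6 * (d * κ) / κ = 6 * d := by field_simp
    rw [this]
    have := mul_nonneg hd0.le hm0
    linarith
  · intro X Y hXY hU
    by_contra hh
    push Not at hh
    rcases le_total (pc A X Rᶜ : ℝ) (pc A Y Rᶜ) with h | h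
    · rw [min_eq_left h] at hh
      exact key X Y hXY hU h hh
    · rw [min_eq_right h, symA X Y] at hh
      exact key Y X hXY.symm (by rw [Set.union_comm, hU]) h hh

theorem bigSubgraphContainsExpander {V : Type*} [Fintype V]
    (κ ε : ℝ) (hκ0 : 0 < κ) (hκ1 : κ ≤ 1) (hε0 : 0 < ε) (hε : ε < κ / 6)
    (G : SimpleGraph V) (hG : IsExpander G κ)
    (s : Set V) (H : SimpleGraph s) (hH : H ≤ G.induce s)
    (he : (1 - ε) * (edgeCount G : ℝ) ≤ (edgeCount H : ℝ)) :
    ∃ t : Set s,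
      (1 - 6 * ε / κ) * (edgeCount G : ℝ) ≤ (edgeCount (H.induce t) : ℝ) ∧
      IsExpander (H.induce t) (κ / 3) := by
  let A : V → V → Prop := fun x y => ∃ (hx : x ∈ s) (hy : y ∈ s), H.Adj ⟨x, hx⟩ ⟨y, hy⟩
  have hAs : ∀ x y, A x y → A y x := fun x y ⟨hx, hy, h⟩ => ⟨hy, hx, h.symm⟩
  have hAG : ∀ x y, A x y → G.Adj x y := fun x y ⟨hx, hy, h⟩ => hH h
  have hHA : ∀ x y : s, H.Adj x y ↔ A x y := fun x y =>
    ⟨fun h => ⟨x.2, y.2, h⟩, fun ⟨_, _, h⟩ => h⟩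
  have restr : ∀ P Q P' Q' : Set V, P ∩ s = P' ∩ s → Q ∩ s = Q' ∩ s → pc A P Q = pc A P' Q' := by
    intro P Q P' Q' h1 h2
    refine le_antisymm (pc_mono ?_) (pc_mono ?_)
    · intro x hx y hy h
      exact ⟨h, (h1 ▸ (⟨hx, h.1⟩ : x ∈ P ∩ s) : x ∈ P' ∩ s).1,
        (h2 ▸ (⟨hy, h.2.1⟩ : y ∈ Q ∩ s) : y ∈ Q' ∩ s).1⟩
    · intro x hx y hy h
      exact ⟨h, (h1 ▸ (⟨hx, h.1⟩ : x ∈ P' ∩ s) : x ∈ P ∩ s).1,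
        (h2 ▸ (⟨hy, h.2.1⟩ : y ∈ Q' ∩ s) : y ∈ Q ∩ s).1⟩
  have hGe : (pc G.Adj Set.univ Set.univ : ℝ) = 2 * (edgeCount G : ℝ) := by
    rw [← edge_eq_pc]; push_cast; rfl
  have hHe : (pc A Set.univ Set.univ : ℝ) = 2 * (edgeCount H : ℝ) := by
    have h1 := edge_eq_pc H
    rw [pc_transfer H.Adj A Subtype.val Subtype.val_injective hHA,
      restr _ _ Set.univ Set.univ (by simp) (by simp)] at h1
    rw [← h1]; push_cast; rfl
  obtain ⟨U, hU1, hU2⟩ := bigcore κ ε hκ0 hκ1 hε0 hε A G.Adj hAs (fun x y h => h.symm) hAG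
    (edgeCount G) hGe
    (fun X => by
      have := hG X
      rwa [vol_eq_pc, vol_eq_pc, cut_eq_pc] at this)
    (by rw [hHe]; linarith)
  let t : Set s := Subtype.val ⁻¹' U
  let φ : t → V := fun x => x.1.1
  have hφ : Function.Injective φ := fun x y h => Subtype.ext (Subtype.ext h)
  have hKA : ∀ x y : t, (H.induce t).Adj x y ↔ A (φ x) (φ y) := fun x y => hHA x.1 y.1
  have him : φ '' Set.univ = U ∩ s := by
    ext v
    constructor
    · rintro ⟨x, -, rfl⟩
      exact ⟨x.2, x.1.2⟩
    · rintro ⟨h1, h2⟩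
      exact ⟨⟨⟨v, h2⟩, h1⟩, trivial, rfl⟩
  have himU : φ '' Set.univ ∩ s = U ∩ s := by rw [him, Set.inter_assoc, Set.inter_self]
  refine ⟨t, ?_, ?_⟩
  · have h1 := edge_eq_pc (H.induce t)
    rw [pc_transfer _ A φ hφ hKA, restr _ _ U U himU himU] at h1
    rw [← h1] at hU1
    push_cast at hU1
    linarith
  · intro X
    rw [vol_eq_pc, vol_eq_pc, cut_eq_pc, pc_transfer _ A φ hφ hKA, pc_transfer _ A φ hφ hKA,
      pc_transfer _ A φ hφ hKA]
    have hXs : φ '' X ⊆ s := by rintro _ ⟨x, -, rfl⟩; exact x.1.2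
    have hd : Disjoint (φ '' X) (φ '' Xᶜ ∪ (U \ s)) := by
      rw [Set.disjoint_union_right]
      refine ⟨(Set.disjoint_image_iff hφ).2 disjoint_compl_right, ?_⟩
      exact Set.disjoint_left.2 fun v hv hv' => hv'.2 (hXs hv)
    have h2 := hU2 (φ '' X) (φ '' Xᶜ ∪ (U \ s)) hd (by
      rw [← Set.union_assoc, ← Set.image_union, Set.union_compl_self, him, Set.inter_union_diff])
    have hY : (φ '' Xᶜ ∪ (U \ s)) ∩ s = φ '' Xᶜ ∩ s := by
      rw [Set.union_inter_distrib_right, Set.diff_inter_self, Set.union_empty]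
    rw [restr (φ '' X) U (φ '' X) (φ '' Set.univ) rfl himU.symm,
      restr _ U (φ '' Xᶜ) (φ '' Set.univ) hY himU.symm, restr (φ '' X) _ (φ '' X) (φ '' Xᶜ) rfl hY] at h2
    exact h2
end

section
/- For all κ, α > 0 and all 0 < α' < α, there exists κ' > 0 such that the following holds for every finite graph G. If there exists a graph H such that e(H) ≥ α·e(G), H is a topological minor of G, and H is a κ-expander, then there exists a graph H* such that e(H*) ≥ α'·e(G), H* is an induced subgraph of G, and H* is a κ'-expander. -/
/-- The internal vertices of a walk: its support with the two endpoints removed. -/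
def walkInternal {V : Type*} {G : SimpleGraph V} {u v : V} (p : G.Walk u v) : List V :=
  p.support.tail.dropLast

/-- `G` is a subdivision of `H`: there are an injection `φ : V(H) → V(G)` and, for each edge
`{u, v}` of `H`, a path in `G` from `φ u` to `φ v` of length at least 1 (the choice depending
only on the edge, not its orientation), such that these paths are pairwise internally
vertex-disjoint, their internal vertices avoid `φ(V(H))`, and every vertex and every edge of
`G` lies in the image of `φ` or on one of these paths. -/
def IsSubdivision {W V : Type*} (G : SimpleGraph V) (H : SimpleGraph W) : Prop :=
  ∃ (φ : W → V) (P : ∀ u v : W, H.Adj u v → G.Walk (φ u) (φ v)),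
    Function.Injective φ ∧
    (∀ u v huv, (P u v huv).IsPath) ∧
    (∀ u v huv, 1 ≤ (P u v huv).length) ∧
    (∀ u v huv, P v u huv.symm = (P u v huv).reverse) ∧
    (∀ u v huv, ∀ w ∈ walkInternal (P u v huv), w ∉ Set.range φ) ∧
    (∀ u v huv u' v' huv', s(u, v) ≠ s(u', v') →
      ∀ w ∈ walkInternal (P u v huv), w ∉ walkInternal (P u' v' huv')) ∧
    (∀ x : V, x ∈ Set.range φ ∨ ∃ u v huv, x ∈ (P u v huv).support) ∧
    (∀ e ∈ G.edgeSet, ∃ u v huv, e ∈ (P u v huv).edges)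

/-- `H` is a topological minor of `G`: some subgraph of `G` (a graph on a vertex subset `S`
whose edges are among those of `G.induce S`) is a subdivision of `H`. -/
def IsTopologicalMinor {W V : Type*} (H : SimpleGraph W) (G : SimpleGraph V) : Prop :=
  ∃ (S : Set V) (G' : SimpleGraph S), G' ≤ G.induce S ∧ IsSubdivision G' H

/-- Number of ordered adjacent pairs from `A` to `B`. -/
noncomputable def pE {V : Type*} (G : SimpleGraph V) (A B : Set V) : ℕ :=
  Set.ncard {p : V × V | p.1 ∈ A ∧ p.2 ∈ B ∧ G.Adj p.1 p.2}

theorem pE_mono {V : Type*} [Finite V] (G : SimpleGraph V) {A B A' B' : Set V}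
    (h : A ⊆ A') (h' : B ⊆ B') : pE G A B ≤ pE G A' B' :=
  Set.ncard_le_ncard (fun _ hp => ⟨h hp.1, h' hp.2.1, hp.2.2⟩) (Set.toFinite _)

theorem pE_symm {V : Type*} (G : SimpleGraph V) (A B : Set V) : pE G A B = pE G B A := by
  unfold pE
  rw [← Set.ncard_image_of_injective _ (Prod.swap_injective (α := V) (β := V))]
  congr 1
  ext ⟨x, y⟩
  simp [G.adj_comm]
  tauto

theorem pE_right {V : Type*} [Finite V] (G : SimpleGraph V) (A : Set V) {B C D : Set V}
    (hd : Disjoint B C) (hu : B ∪ C = D) : pE G A D = pE G A B + pE G A C := by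
  unfold pE
  rw [← Set.ncard_union_eq _ (Set.toFinite _) (Set.toFinite _)]
  · congr 1
    ext ⟨x, y⟩
    subst hu
    simp
    tauto
  · rw [Set.disjoint_left] at hd ⊢
    intro p hp hp'
    exact hd hp.2.1 hp'.2.1

theorem pE_left {V : Type*} [Finite V] (G : SimpleGraph V) (A : Set V) {B C D : Set V}
    (hd : Disjoint B C) (hu : B ∪ C = D) : pE G D A = pE G B A + pE G C A := by
  rw [pE_symm, pE_right G A hd hu, pE_symm G A B, pE_symm G A C]

theorem pE_empty {V : Type*} (G : SimpleGraph V) (A : Set V) : pE G ∅ A = 0 := by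
  simp [pE]

theorem cut_eq {V : Type*} (G : SimpleGraph V) (X : Set V) : cut G X = pE G X Xᶜ := rfl

theorem vol_eq {V : Type*} [Finite V] (G : SimpleGraph V) (X : Set V) :
    vol G X = pE G X Set.univ := by
  classical
  induction X, Set.toFinite X using Set.Finite.induction_on with
  | empty => simp [vol, pE]
  | @insert a s ha _ ih =>
    rw [pE_left G Set.univ (B := {a}) (C := s) (by simpa using ha) Set.singleton_union, ← ih]
    unfold vol
    rw [finsum_mem_insert _ ha (Set.toFinite _)]
    congr 1
    unfold vdeg pE
    rw [Nat.card_coe_set_eq,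
      ← Set.ncard_image_of_injective (f := fun y => (a, y)) _ (fun _ _ h => (Prod.mk.inj h).2)]
    congr 1
    ext ⟨x, y⟩
    simp
    constructor
    · rintro ⟨h, rfl⟩; exact ⟨rfl, h⟩
    · rintro ⟨rfl, h⟩; exact ⟨h, rfl⟩

theorem edgeCount_eq {V : Type*} [Finite V] (G : SimpleGraph V) :
    2 * edgeCount G = pE G Set.univ Set.univ := by
  classical
  cases nonempty_fintype V
  have h := G.sum_degrees_eq_twice_card_edges
  rw [← vol_eq]
  unfold vol edgeCount
  rw [finsum_mem_univ, finsum_eq_sum_of_fintype, Nat.card_eq_fintype_card,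
    ← SimpleGraph.edgeFinset_card, ← h]
  refine Finset.sum_congr rfl fun v _ => ?_
  unfold vdeg
  rw [Nat.card_eq_fintype_card, SimpleGraph.card_neighborSet_eq_degree]

theorem pE_induce {V : Type*} (G : SimpleGraph V) (S : Set V) (A B : Set S) :
    pE (G.induce S) A B = pE G (Subtype.val '' A) (Subtype.val '' B) := by
  unfold pE
  rw [← Set.ncard_image_of_injective _
    (Function.Injective.prodMap (Subtype.val_injective (p := fun x => x ∈ S)) 
      (Subtype.val_injective (p := fun x => x ∈ S)))]
  congr 1
  ext ⟨x, y⟩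
  constructor
  · rintro ⟨⟨a, b⟩, ⟨h1, h2, h3⟩, h4⟩
    obtain ⟨rfl, rfl⟩ := Prod.mk.inj h4
    exact ⟨⟨a, h1, rfl⟩, ⟨b, h2, rfl⟩, h3⟩
  · rintro ⟨⟨a, h1, ha⟩, ⟨b, h2, hb⟩, h3⟩
    dsimp only at ha hb h3
    subst ha hb
    exact ⟨(a, b), ⟨h1, h2, h3⟩, rfl⟩

theorem mem_support_cases {V : Type*} {G : SimpleGraph V} {u v : V} (p : G.Walk u v) {w : V}
    (hw : w ∈ p.support) : w = u ∨ w = v ∨ w ∈ walkInternal p := by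
  unfold walkInternal
  rw [SimpleGraph.Walk.mem_support_iff] at hw
  rcases hw with h | h
  · exact Or.inl h
  · right
    have hne : p.support.tail ≠ [] := List.ne_nil_of_mem h
    rw [← List.dropLast_append_getLast hne] at h
    rcases List.mem_append.1 h with h | h
    · exact Or.inr h
    · left
      rw [List.mem_singleton] at h
      rw [h, List.getLast_tail, SimpleGraph.Walk.getLast_support]

theorem prop_aux {a b c d I J R : Prop} (h1 : a ∨ b ∨ I) (h2 : c ∨ d ∨ J) (h3 : I → ¬ J)
    (h4 : I → ¬ R) (h5 : J → ¬ R) (r1 : a → R) (r2 : b → R) (r3 : c → R) (r4 : d → R) :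
    (a ∨ b) ∧ (c ∨ d) := by
  tauto

theorem topMinor_facts {W V : Type*} {H : SimpleGraph W} {G : SimpleGraph V}
    (h : IsTopologicalMinor H G) :
    ∃ (φ : W → V) (P : ∀ u v : W, H.Adj u v → G.Walk (φ u) (φ v)), Function.Injective φ ∧
      ∀ u v huv u' v' huv' e, e ∈ (P u v huv).edges → e ∈ (P u' v' huv').edges →
        s(u, v) = s(u', v') := by
  obtain ⟨S, G', hle, φ, P, hinj, -, -, -, hav, hdis, -, -⟩ := h
  let f : G' →g G := (SimpleGraph.Embedding.induce S).toHom.comp (SimpleGraph.Hom.ofLE hle)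
  have hf : Function.Injective f := Subtype.val_injective
  refine ⟨fun w => f (φ w), fun u v h => (P u v h).map f, hf.comp hinj, ?_⟩
  intro u v huv u' v' huv' e he he'
  simp only [SimpleGraph.Walk.edges_map, List.mem_map] at he he'
  obtain ⟨e, he, rfl⟩ := he
  obtain ⟨e', he', hee⟩ := he'
  obtain rfl := Sym2.map.injective hf hee
  by_contra hne
  have key : ∀ x, x ∈ (P u v huv).support → x ∈ (P u' v' huv').support →
      (x = φ u ∨ x = φ v) ∧ (x = φ u' ∨ x = φ v') := by
    intro x hx hx'
    have h1 := mem_support_cases _ hx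
    have h2 := mem_support_cases _ hx'
    have h3 := hdis u v huv u' v' huv' hne x
    have h4 := hav u v huv x
    have h5 := hav u' v' huv' x
    have r : x ∈ (P u v huv).support → ∀ w, x = φ w → x ∈ Set.range φ :=
      fun _ w hw => ⟨w, hw.symm⟩
    have r1 := r hx u
    have r2 := r hx v
    have r3 := r hx u'
    have r4 := r hx v'
    exact prop_aux h1 h2 h3 h4 h5 r1 r2 r3 r4
  induction e' using Sym2.ind with
  | _ x y =>
    have hxy : x ≠ y := (SimpleGraph.Walk.adj_of_mem_edges _ he).ne
    have kx := key x (SimpleGraph.Walk.fst_mem_support_of_mem_edges _ he)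
      (SimpleGraph.Walk.fst_mem_support_of_mem_edges _ he')
    have ky := key y (SimpleGraph.Walk.snd_mem_support_of_mem_edges _ he)
      (SimpleGraph.Walk.snd_mem_support_of_mem_edges _ he')
    apply hne
    apply Sym2.map.injective hinj
    simp only [Sym2.map_mk]
    trans s(x, y)
    · rw [Sym2.eq_iff]; grind
    · rw [Sym2.eq_iff]; grind

theorem cut_transfer {W V : Type*} [Finite W] [Finite V] {H : SimpleGraph W} {G : SimpleGraph V}
    {φ : W → V} (P : ∀ u v : W, H.Adj u v → G.Walk (φ u) (φ v))
    (hP : ∀ u v huv u' v' huv' e, e ∈ (P u v huv).edges → e ∈ (P u' v' huv').edges →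
        s(u, v) = s(u', v')) (A : Set V) :
    pE H (φ ⁻¹' A) (φ ⁻¹' A)ᶜ ≤ pE G A Aᶜ := by
  classical
  have h : ∀ p : W × W, ∃ q : V × V, p ∈ {p : W × W | p.1 ∈ φ ⁻¹' A ∧ p.2 ∈ (φ ⁻¹' A)ᶜ ∧
      H.Adj p.1 p.2} → (q.1 ∈ A ∧ q.2 ∈ Aᶜ ∧ G.Adj q.1 q.2) ∧
      ∃ h, s(q.1, q.2) ∈ (P p.1 p.2 h).edges := by
    intro p
    by_cases hp : p ∈ {p : W × W | p.1 ∈ φ ⁻¹' A ∧ p.2 ∈ (φ ⁻¹' A)ᶜ ∧ H.Adj p.1 p.2}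
    · obtain ⟨h1, h2, h3⟩ := hp
      obtain ⟨d, hd, hd1, hd2⟩ := (P p.1 p.2 h3).exists_boundary_dart A h1 h2
      refine ⟨(d.fst, d.snd), fun _ => ⟨⟨hd1, hd2, d.adj⟩, h3, ?_⟩⟩
      exact List.mem_map.2 ⟨d, hd, rfl⟩
    · exact ⟨(φ p.1, φ p.2), fun h => absurd h hp⟩
  choose f hf using h
  refine Set.ncard_le_ncard_of_injOn f (fun p hp => (hf p hp).1) ?_ (Set.toFinite _)
  intro p hp q hq hpq
  obtain ⟨-, a, ha⟩ := hf p hp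
  obtain ⟨-, b, hb⟩ := hf q hq
  rw [← hpq] at hb
  have := hP _ _ _ _ _ _ _ ha hb
  rw [Sym2.eq_iff] at this
  rcases this with ⟨h1, h2⟩ | ⟨h1, h2⟩
  · exact Prod.ext h1 h2
  · exact absurd (h1 ▸ hp.1) hq.2.1

theorem vol_transfer {W V : Type*} [Finite W] [Finite V] {H : SimpleGraph W} {G : SimpleGraph V}
    {φ : W → V} (hφ : Function.Injective φ) (P : ∀ u v : W, H.Adj u v → G.Walk (φ u) (φ v))
    (hP : ∀ u v huv u' v' huv' e, e ∈ (P u v huv).edges → e ∈ (P u' v' huv').edges →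
        s(u, v) = s(u', v')) (A : Set V) :
    pE H (φ ⁻¹' A) Set.univ ≤ pE G A Set.univ := by
  classical
  have h : ∀ p : W × W, ∃ q : V × V, p ∈ {p : W × W | p.1 ∈ φ ⁻¹' A ∧ p.2 ∈ Set.univ ∧
      H.Adj p.1 p.2} → (q.1 ∈ A ∧ q.2 ∈ Set.univ ∧ G.Adj q.1 q.2) ∧ q.1 = φ p.1 ∧ 
      ∃ h, s(q.1, q.2) ∈ (P p.1 p.2 h).edges := by
    intro p
    by_cases hp : p ∈ {p : W × W | p.1 ∈ φ ⁻¹' A ∧ p.2 ∈ Set.univ ∧ H.Adj p.1 p.2}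
    · obtain ⟨h1, h2, h3⟩ := hp
      have hne : φ p.1 ≠ φ p.2 := fun h => h3.ne (hφ h)
      obtain ⟨d, hd, hd1, hd2⟩ := (P p.1 p.2 h3).exists_boundary_dart {φ p.1} rfl hne.symm
      refine ⟨(d.fst, d.snd), fun _ => ⟨⟨?_, trivial, d.adj⟩, hd1, h3, ?_⟩⟩
      · rw [Set.mem_singleton_iff.1 hd1]; exact h1
      · exact List.mem_map.2 ⟨d, hd, rfl⟩
    · exact ⟨(φ p.1, φ p.2), fun h => absurd h hp⟩
  choose f hf using h
  refine Set.ncard_le_ncard_of_injOn f (fun p hp => (hf p hp).1) ?_ (Set.toFinite _)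
  intro p hp q hq hpq
  obtain ⟨-, a', a, ha⟩ := hf p hp
  obtain ⟨-, b', b, hb⟩ := hf q hq
  rw [← hpq] at hb b'
  have := hP _ _ _ _ _ _ _ ha hb
  have h1 : p.1 = q.1 := hφ (a'.symm.trans b')
  rw [h1] at this
  exact Prod.ext h1 (Sym2.congr_right.1 this)

/-- One pruning step. -/
theorem prune_step {W V : Type*} [Finite W] [Finite V] {H : SimpleGraph W} {G : SimpleGraph V}
    {φ : W → V} {κ α κ' : ℝ} (hα : 0 < α) (hκ' : 0 < κ') (hk : 8 * κ' ≤ α * κ)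
    (hcut : ∀ A : Set V, pE H (φ ⁻¹' A) (φ ⁻¹' A)ᶜ ≤ pE G A Aᶜ)
    (hexp : IsExpander H κ) (hG : 0 < edgeCount G)
    (hGH : α * (edgeCount G : ℝ) ≤ (edgeCount H : ℝ))
    {S A B : Set V} (hd : Disjoint A B) (hu : A ∪ B = S)
    (hS : (pE G S Sᶜ : ℝ) ≤ κ' * (2 * edgeCount G - pE G S S))
    (hmaj : vol H (φ ⁻¹' S)ᶜ ≤ vol H (φ ⁻¹' S))
    (hAB : (pE G A B : ℝ) ≤ κ' * pE G B S)
    (hbig : vol H (φ ⁻¹' B) ≤ vol H (φ ⁻¹' A)) :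
    (pE G A Aᶜ : ℝ) ≤ κ' * (2 * edgeCount G - pE G A A) ∧
      vol H (φ ⁻¹' A)ᶜ ≤ vol H (φ ⁻¹' A) := by
  have hAS : A ⊆ S := hu ▸ Set.subset_union_left
  have e1 : pE G A Aᶜ = pE G A B + pE G A Sᶜ := by
    apply pE_right
    · rw [Set.disjoint_left] at hd ⊢
      intro x hx hx'
      exact hx' (hu ▸ Or.inr hx)
    · subst hu
      ext x
      have := (Set.disjoint_left.1 hd : ∀ ⦃a⦄, a ∈ A → a ∉ B) (a := x)
      simp
      tauto
  have e2 : pE G A Sᶜ ≤ pE G S Sᶜ := pE_mono G hAS le_rfl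
  have e3 : pE G S S = pE G A S + pE G B S := pE_left G S hd hu
  have e4 : pE G A S = pE G A A + pE G A B := pE_right G A hd hu
  have c1 : (pE G A Aᶜ : ℝ) ≤ κ' * (2 * edgeCount G - pE G A A) := by
    have e1' : (pE G A Aᶜ : ℝ) = pE G A B + pE G A Sᶜ := by exact_mod_cast e1
    have e2' : (pE G A Sᶜ : ℝ) ≤ pE G S Sᶜ := by exact_mod_cast e2
    have e3' : (pE G S S : ℝ) = pE G A A + pE G A B + pE G B S := by
      exact_mod_cast (by omega : pE G S S = pE G A A + pE G A B + pE G B S)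
    have : 0 ≤ κ' * (pE G A B : ℝ) := by positivity
    rw [e3'] at hS
    nlinarith
  refine ⟨c1, ?_⟩
  by_contra hlt
  push Not at hlt
  have hx := hexp (φ ⁻¹' A)
  rw [min_eq_left (by exact_mod_cast hlt.le), cut_eq] at hx
  have hc : (pE H (φ ⁻¹' A) (φ ⁻¹' A)ᶜ : ℝ) ≤ pE G A Aᶜ := by exact_mod_cast hcut A
  have v1 : vol H (φ ⁻¹' S) = vol H (φ ⁻¹' A) + vol H (φ ⁻¹' B) := by
    simp only [vol_eq]
    apply pE_left
    · exact hd.preimage φ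
    · rw [← Set.preimage_union, hu]
  have v2 : 2 * edgeCount H = vol H (φ ⁻¹' S) + vol H (φ ⁻¹' S)ᶜ := by
    simp only [vol_eq, edgeCount_eq]
    apply pE_left
    · exact disjoint_compl_right
    · simp
  have v3 : (edgeCount H : ℝ) ≤ 2 * vol H (φ ⁻¹' A) := by
    exact_mod_cast (by omega : edgeCount H ≤ 2 * vol H (φ ⁻¹' A))
  have hm : (0 : ℝ) < edgeCount G := by exact_mod_cast hG
  have h1 : (pE G A Aᶜ : ℝ) ≤ 2 * κ' * edgeCount G := by
    have : 0 ≤ κ' * (pE G A A : ℝ) := by positivity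
    linarith
  have hκ : 0 < κ := by
    by_contra h
    have := mul_nonneg hα.le (not_lt.1 h |> neg_nonneg.2)
    linarith
  have h2 : κ * (α * edgeCount G) ≤ κ * (2 * vol H (φ ⁻¹' A)) :=
    mul_le_mul_of_nonneg_left (hGH.trans v3) hκ.le
  have h3 : 8 * κ' * edgeCount G ≤ α * κ * edgeCount G :=
    mul_le_mul_of_nonneg_right hk hm.le
  have h4 : 0 < κ' * (edgeCount G : ℝ) := by positivity
  nlinarith

universe u

/-- For all `κ, α > 0` and `0 < α' < α` there exists `κ' > 0` such that:
for every finite graph `G`, if some finite graph `H` with `e(H) ≥ α·e(G)` is a topological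
minor of `G` and a `κ`-expander, then some induced subgraph `H* = G.induce S` of `G` satisfies
`e(H*) ≥ α'·e(G)` and is a `κ'`-expander. -/
theorem topMinor_expander_to_induced_expander
    (κ α α' : ℝ) (hκ : 0 < κ) (hα : 0 < α) (hα'0 : 0 < α') (hα' : α' < α) :
    ∃ κ' : ℝ, 0 < κ' ∧
      ∀ (V : Type u) [Fintype V] (G : SimpleGraph V),
        (∃ (W : Type u) (_ : Fintype W) (H : SimpleGraph W),
          α * (edgeCount G : ℝ) ≤ (edgeCount H : ℝ) ∧
          IsTopologicalMinor H G ∧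
          IsExpander H κ) →
        ∃ S : Set V,
          α' * (edgeCount G : ℝ) ≤ (edgeCount (G.induce S) : ℝ) ∧
          IsExpander (G.induce S) κ' := by
  refine ⟨min (α * κ / 8) ((α - α') * κ / (1 + κ)), ?_, ?_⟩
  · have : 0 < α - α' := by linarith
    positivity
  set κ' := min (α * κ / 8) ((α - α') * κ / (1 + κ)) with hκ'def
  have hκ' : 0 < κ' := by
    have : 0 < α - α' := by linarith
    positivity
  have hk1 : 8 * κ' ≤ α * κ := by
    have := min_le_left (α * κ / 8) ((α - α') * κ / (1 + κ))
    linarith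
  have hk2 : κ' * (1 + κ) ≤ (α - α') * κ := by
    have := min_le_right (α * κ / 8) ((α - α') * κ / (1 + κ))
    rwa [← hκ'def, le_div_iff₀ (by positivity)] at this
  clear_value κ'
  intro V _ G ⟨W, _, H, hGH, htop, hexp⟩
  obtain ⟨φ, P, hφ, hP⟩ := topMinor_facts htop
  have hcut := cut_transfer P hP
  have hvol := vol_transfer hφ P hP
  have hind : ∀ S : Set V, 2 * edgeCount (G.induce S) = pE G S S := by
    intro S
    rw [edgeCount_eq, pE_induce]
    simp
  rcases Nat.eq_zero_or_pos (edgeCount G) with hm | hm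
  · refine ⟨Set.univ, by simp [hm], ?_⟩
    intro X
    have h1 : vol (G.induce Set.univ) X = 0 := by
      rw [vol_eq]
      have h2 := pE_mono (G.induce Set.univ) (Set.subset_univ X) (le_refl Set.univ)
      have h3 := hind Set.univ
      rw [edgeCount_eq] at h3
      have h4 := edgeCount_eq G
      omega
    rw [h1]
    have : min ((0 : ℕ) : ℝ) (vol (G.induce Set.univ) Xᶜ : ℝ) ≤ 0 := by
      simp
    have h2 := mul_nonpos_of_nonneg_of_nonpos hκ'.le this
    exact h2.trans (Nat.cast_nonneg _)
  let good : Set V → Prop := fun S =>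
    (pE G S Sᶜ : ℝ) ≤ κ' * (2 * edgeCount G - pE G S S) ∧
      vol H (φ ⁻¹' S)ᶜ ≤ vol H (φ ⁻¹' S)
  have hgood : good Set.univ := by
    constructor
    · have : (2 * edgeCount G : ℝ) = pE G Set.univ Set.univ := by exact_mod_cast edgeCount_eq G
      rw [this, Set.compl_univ, pE_symm, pE_empty]
      simp
    · simp [vol]
  obtain ⟨S, hS, hmin⟩ := (Set.toFinite {S : Set V | good S}).exists_minimal ⟨_, hgood⟩
  have hmR : (0 : ℝ) < edgeCount G := by exact_mod_cast hm
  refine ⟨S, ?_, ?_⟩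
  · obtain ⟨h1, h2⟩ := hS
    have hx := hexp (φ ⁻¹' S)
    rw [min_eq_right (by exact_mod_cast h2), cut_eq] at hx
    have hc : (pE H (φ ⁻¹' S) (φ ⁻¹' S)ᶜ : ℝ) ≤ pE G S Sᶜ := by exact_mod_cast hcut S
    have hv := hvol S
    rw [← vol_eq, pE_right G S (B := S) (C := Sᶜ) disjoint_compl_right (by simp)] at hv
    have v2 : 2 * edgeCount H = vol H (φ ⁻¹' S) + vol H (φ ⁻¹' S)ᶜ := by
      simp only [vol_eq, edgeCount_eq]
      apply pE_left
      · exact disjoint_compl_right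
      · simp
    have h3 : (2 * edgeCount H : ℝ) ≤ 2 * edgeCount (G.induce S) + pE G S Sᶜ
        + vol H (φ ⁻¹' S)ᶜ := by
      have := hind S
      exact_mod_cast (by omega : 2 * edgeCount H ≤ 2 * edgeCount (G.induce S) + pE G S Sᶜ
        + vol H (φ ⁻¹' S)ᶜ)
    have h4 : (pE G S Sᶜ : ℝ) ≤ 2 * κ' * edgeCount G := by
      have : 0 ≤ κ' * (pE G S S : ℝ) := by positivity
      linarith
    have h5 : κ' * (1 + κ) * edgeCount G ≤ (α - α') * κ * edgeCount G :=
      mul_le_mul_of_nonneg_right hk2 hmR.le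
    have h6 := mul_le_mul_of_nonneg_left h3 hκ.le
    have h7 := mul_le_mul_of_nonneg_left hGH hκ.le
    have h8 := mul_le_mul_of_nonneg_left h4 hκ.le
    refine le_of_mul_le_mul_left ?_ hκ
    linarith
  · intro X
    by_contra hlt
    push Not at hlt
    rw [cut_eq, vol_eq, vol_eq, pE_induce, pE_induce, pE_induce] at hlt
    have hus : (Subtype.val '' (Set.univ : Set S)) = S := by simp
    rw [hus] at hlt
    set A : Set V := Subtype.val '' X with hA
    set B : Set V := Subtype.val '' Xᶜ with hB
    have hd : Disjoint A B :=
      (Set.disjoint_image_iff Subtype.val_injective).2 disjoint_compl_right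
    have hu : A ∪ B = S := by rw [hA, hB, ← Set.image_union]; simp
    clear_value A B
    have key : ∀ A B : Set V, Disjoint A B → A ∪ B = S →
        (pE G A B : ℝ) < κ' * pE G B S →
        vol H (φ ⁻¹' B) ≤ vol H (φ ⁻¹' A) → False := by
      intro A B hd hu hAB hbig
      have hg : good A := prune_step hα hκ' hk1 hcut hexp hm hGH hd hu hS.1 hS.2 hAB.le hbig
      have hSA : S ⊆ A := hmin hg (hu ▸ Set.subset_union_left)
      have hBe : B = ∅ := by
        rw [Set.eq_empty_iff_forall_notMem]
        intro x hx
        exact Set.disjoint_left.1 hd (hSA (hu ▸ Or.inr hx)) hx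
      rw [hBe, pE_empty] at hAB
      have : (0 : ℝ) ≤ pE G A ∅ := Nat.cast_nonneg _
      simp at hAB
      linarith
    have l1 := mul_le_mul_of_nonneg_left (min_le_left (pE G A S : ℝ) (pE G B S)) hκ'.le
    have l2 := mul_le_mul_of_nonneg_left (min_le_right (pE G A S : ℝ) (pE G B S)) hκ'.le
    rcases le_total (vol H (φ ⁻¹' B)) (vol H (φ ⁻¹' A)) with h | h
    · exact key A B hd hu (by linarith) h
    · exact key B A hd.symm (by rw [Set.union_comm, hu]) (by rw [pE_symm]; linarith) h
end

section
/- For all κ, α > 0 and all 0 < α' < α, there exists κ' > 0 such that the following holds for every finite graph G. If there exists a graph H such that e(H) ≥ α·e(G), H is a topological minor of G, and H is a κ-expander, then there exists a graph H* such that e(H*) ≥ α'·e(G), H* is a subgraph of G, and H* is a κ'-expander. -/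
universe u

section Helpers
open Classical Finset

theorem aux_sym2_fiber {V : Type*} [Fintype V] (e : Sym2 V) :
    #(univ.filter fun p : V × V => s(p.1, p.2) = e) ≤ 2 := by
  induction e using Sym2.ind with
  | _ x y =>
    refine le_trans (card_le_card (t := {(x, y), (y, x)}) ?_) card_le_two
    rintro ⟨a, b⟩ h
    simp at h ⊢
    exact h

theorem aux_vol {V : Type*} [Fintype V] (G : SimpleGraph V) (X : Set V) :
    vol G X = #(univ.filter fun p : V × V => p.1 ∈ X ∧ G.Adj p.1 p.2) := by
  have h1 : vol G X = ∑ v ∈ univ.filter (fun v => v ∈ X), vdeg G v := by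
    unfold vol
    rw [finsum_mem_eq_sum_of_inter_support_eq]
    ext v; simp
  rw [h1]
  rw [card_eq_sum_card_fiberwise (f := Prod.fst) (t := univ.filter (fun v => v ∈ X))]
  · apply sum_congr rfl
    intro v hv
    have hv' : v ∈ X := by simpa using hv
    unfold vdeg
    rw [Nat.card_eq_fintype_card, ← Set.toFinset_card]
    symm
    apply card_bij (fun p _ => p.2)
    · rintro ⟨a, b⟩ h
      simp at h ⊢
      obtain ⟨⟨_, h⟩, rfl⟩ := h
      exact h
    · rintro ⟨a, b⟩ h ⟨c, d⟩ h'
      simp at h h' ⊢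
      grind
    · intro b hb
      exact ⟨(v, b), by simpa [hv'] using hb, rfl⟩
  · rintro ⟨a, b⟩ h
    simp at h ⊢
    exact h.1

theorem aux_cut {V : Type*} [Fintype V] (G : SimpleGraph V) (X : Set V) :
    cut G X = #(univ.filter fun p : V × V => p.1 ∈ X ∧ p.2 ∉ X ∧ G.Adj p.1 p.2) := by
  unfold cut
  rw [Nat.card_eq_fintype_card, Fintype.card_subtype]

/-- number of ordered adjacent pairs -/
noncomputable def nd {V : Type*} [Fintype V] (G : SimpleGraph V) : ℕ :=
  #(univ.filter fun p : V × V => G.Adj p.1 p.2)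

theorem aux_nd {V : Type*} [Fintype V] (G : SimpleGraph V) : nd G = 2 * edgeCount G := by
  have h := G.dart_card_eq_twice_card_edges
  unfold edgeCount nd
  rw [Nat.card_eq_fintype_card, ← SimpleGraph.edgeFinset_card, ← h, ← Fintype.card_subtype]
  apply Fintype.card_congr
  exact ⟨fun p => ⟨p.1, p.2⟩, fun d => ⟨d.toProd, d.adj⟩, fun _ => rfl, fun _ => rfl⟩

theorem aux_vol_compl {V : Type*} [Fintype V] (G : SimpleGraph V) (X : Set V) :
    vol G X + vol G Xᶜ = nd G := by
  rw [aux_vol, aux_vol, nd, ← card_union_of_disjoint]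
  · congr 1
    ext p; simp; tauto
  · rw [Finset.disjoint_left]
    intro p; simp; tauto

theorem aux_cut_compl {V : Type*} [Fintype V] (G : SimpleGraph V) (X : Set V) :
    cut G Xᶜ = cut G X := by
  rw [aux_cut, aux_cut]
  apply card_bij (fun p _ => p.swap)
  · rintro ⟨a, b⟩ h
    simp at h ⊢
    exact ⟨h.2.1, h.1, h.2.2.symm⟩
  · rintro ⟨a, b⟩ h ⟨c, d⟩ h'
    simp; tauto
  · rintro ⟨a, b⟩ h
    simp at h
    exact ⟨(b, a), by simp; exact ⟨h.2.1, h.1, h.2.2.symm⟩, rfl⟩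

theorem aux_prune {W : Type*} [Fintype W] (H H' : SimpleGraph W) (κ f : ℝ) (hκ : 0 < κ)
    (hκ1 : κ ≤ 1) (hH : IsExpander H κ) (hle : H' ≤ H)
    (hf : (#(univ.filter fun p : W × W => H.Adj p.1 p.2 ∧ ¬ H'.Adj p.1 p.2) : ℝ) ≤ f)
    (hfN : f ≤ κ * nd H / 12) :
    ∃ K : SimpleGraph W, K ≤ H' ∧ IsExpander K (κ / 4) ∧ (nd H : ℝ) - 5 * f / κ ≤ nd K := by
  have hf0 : 0 ≤ f := le_trans (Nat.cast_nonneg _) hf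
  -- choose B
  obtain ⟨B, hB, hBmax⟩ := Finset.exists_max_image
    (univ.filter fun B : Set W => 2 * (vol H B : ℝ) ≤ nd H ∧ (cut H' B : ℝ) ≤ κ / 2 * vol H B)
    (fun B => vol H B) ⟨∅, by simp [aux_vol, aux_cut]⟩
  simp only [mem_filter, mem_univ, true_and] at hB hBmax
  obtain ⟨hB1, hB2⟩ := hB
  have hcutf : ∀ X, (cut H X : ℝ) ≤ cut H' X + f := by
    intro X
    have : cut H X ≤ cut H' X +
        #(univ.filter fun p : W × W => H.Adj p.1 p.2 ∧ ¬ H'.Adj p.1 p.2) := by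
      rw [aux_cut, aux_cut]
      refine le_trans (card_le_card ?_) (card_union_le _ _)
      intro p; simp; tauto
    have : (cut H X : ℝ) ≤ cut H' X +
        #(univ.filter fun p : W × W => H.Adj p.1 p.2 ∧ ¬ H'.Adj p.1 p.2) := by exact_mod_cast this
    linarith
  have hvc : ∀ X, (vol H X : ℝ) + vol H Xᶜ = nd H := fun X => by
    exact_mod_cast aux_vol_compl H X
  have hBf : κ * vol H B ≤ 2 * f := by
    have h1 := hH B
    rw [min_eq_left (by linarith [hvc B])] at h1
    linarith [hcutf B]
  let K : SimpleGraph W :=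
    { Adj := fun x y => H'.Adj x y ∧ x ∉ B ∧ y ∉ B
      symm := ⟨fun x y h => ⟨h.1.symm, h.2.2, h.2.1⟩⟩
      loopless := ⟨fun x h => H'.loopless.irrefl x h.1⟩ }
  have hKadj : ∀ x y, K.Adj x y ↔ H'.Adj x y ∧ x ∉ B ∧ y ∉ B := fun _ _ => Iff.rfl
  have hKH' : K ≤ H' := fun x y h => h.1
  have hndK : (nd H : ℝ) - 5 * f / κ ≤ nd K := by
    have h1 : nd H ≤ nd K + (#(univ.filter fun p : W × W => H.Adj p.1 p.2 ∧ ¬ H'.Adj p.1 p.2)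
        + (vol H B + vol H B)) := by
      have hs : #(univ.filter fun p : W × W => p.2 ∈ B ∧ H.Adj p.1 p.2) ≤ vol H B := by
        rw [aux_vol]
        apply card_le_card_of_injOn Prod.swap
        · rintro ⟨a, b⟩ h
          simp at h ⊢
          exact ⟨h.1, h.2.symm⟩
        · exact Prod.swap_injective.injOn
      refine le_trans ?_ (Nat.add_le_add_left (Nat.add_le_add_left (Nat.add_le_add_left hs _) _) _)
      rw [aux_vol, nd, nd]
      refine le_trans (card_le_card ?_) (le_trans (card_union_le _ _)
        (Nat.add_le_add_left (le_trans (card_union_le _ _)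
        (Nat.add_le_add_left (card_union_le _ _) _)) _))
      intro p; simp [hKadj]; tauto
    have h2 : (nd H : ℝ) ≤ nd K + (#(univ.filter fun p : W × W => H.Adj p.1 p.2 ∧ ¬ H'.Adj p.1 p.2)
        + (vol H B + vol H B)) := by exact_mod_cast h1
    have h3 : f ≤ f / κ := by
      rw [le_div_iff₀ hκ]; nlinarith
    have h4 : (vol H B : ℝ) ≤ 2 * (f / κ) := by
      rw [← mul_div_assoc, le_div_iff₀ hκ]; linarith
    rw [mul_div_assoc]
    linarith
  have hKvc : ∀ X, (vol K X : ℝ) + vol K Xᶜ = nd K := fun X => by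
    exact_mod_cast aux_vol_compl K X
  have hKN : (nd K : ℝ) ≤ nd H := by
    have : nd K ≤ nd H := by
      apply card_le_card
      intro p; simp
      intro h; exact hle (hKH' h)
    exact_mod_cast this
  have key : ∀ X, (vol K X : ℝ) ≤ vol K Xᶜ → κ / 4 * vol K X ≤ cut K X := by
    intro X hX
    by_contra hcon
    push Not at hcon
    have hpos : (0 : ℝ) < vol K X := by
      by_contra h
      have h0 : (vol K X : ℝ) = 0 := le_antisymm (not_lt.mp h) (Nat.cast_nonneg _)
      rw [h0] at hcon
      have : (0 : ℝ) ≤ cut K X := Nat.cast_nonneg _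
      linarith
    have hc : (cut H' (B ∪ X) : ℝ) ≤ cut H' B + cut K X := by
      have : cut H' (B ∪ X) ≤ cut H' B + cut K X := by
        rw [aux_cut, aux_cut, aux_cut]
        refine le_trans (card_le_card ?_) (card_union_le _ _)
        intro p; simp [hKadj]; tauto
      exact_mod_cast this
    have hv : (vol H B : ℝ) + vol K X ≤ vol H (B ∪ X) := by
      have : vol H B + vol K X ≤ vol H (B ∪ X) := by
        rw [aux_vol, aux_vol, aux_vol, ← card_union_of_disjoint]
        · apply card_le_card
          intro p
          have := @hle p.1 p.2
          simp [hKadj]; tauto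
        · rw [Finset.disjoint_left]
          intro p; simp [hKadj]; tauto
      exact_mod_cast this
    have hY : (vol K Xᶜ : ℝ) ≤ vol H (B ∪ X)ᶜ := by
      have : vol K Xᶜ ≤ vol H (B ∪ X)ᶜ := by
        rw [aux_vol, aux_vol]
        apply card_le_card
        intro p
        have := @hle p.1 p.2
        simp [hKadj]; tauto
      exact_mod_cast this
    have hbig : (nd H : ℝ) < 2 * vol H (B ∪ X) := by
      by_contra h
      push Not at h
      have h1 := hBmax (B ∪ X) ⟨h, by nlinarith⟩
      have h2 : (vol H (B ∪ X) : ℝ) ≤ vol H B := by exact_mod_cast h1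
      linarith
    have h1 := hH (B ∪ X)
    rw [min_eq_right (by linarith [hvc (B ∪ X)])] at h1
    have h2 := hcutf (B ∪ X)
    have h3 : κ * (nd H - 5 * f / κ) ≤ 2 * (κ * vol H (B ∪ X)ᶜ) := by
      have : (nd H - 5 * f / κ) ≤ 2 * vol H (B ∪ X)ᶜ := by linarith [hKvc X]
      nlinarith
    have h4 : κ * (nd H - 5 * f / κ) = κ * nd H - 5 * f := by field_simp
    have h5 : κ / 4 * vol K X ≤ κ / 4 * (nd H / 2) := by
      apply mul_le_mul_of_nonneg_left _ (by positivity)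
      linarith [hKvc X]
    linarith
  refine ⟨K, hKH', ?_, hndK⟩
  intro X
  rcases le_total (vol K X : ℝ) (vol K Xᶜ) with h | h
  · rw [min_eq_left h]; exact key X h
  · rw [min_eq_right h, ← aux_cut_compl]
    exact key Xᶜ (by rwa [compl_compl])

theorem aux_mem_support {V : Type*} {G : SimpleGraph V} {u v : V} (p : G.Walk u v) {x : V}
    (hx : x ∈ p.support) : x = u ∨ x = v ∨ x ∈ walkInternal p := by
  cases p with
  | nil => simp at hx; exact Or.inl hx
  | cons h q =>
    simp only [SimpleGraph.Walk.support_cons, List.mem_cons] at hx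
    rcases hx with hx | hx
    · exact Or.inl hx
    · right
      unfold walkInternal
      simp only [SimpleGraph.Walk.support_cons, List.tail_cons]
      rw [← List.dropLast_append_getLast q.support_ne_nil] at hx
      simp only [List.mem_append, List.mem_singleton, SimpleGraph.Walk.getLast_support] at hx
      tauto

theorem aux_disj {W V : Type*} {G : SimpleGraph V} {H : SimpleGraph W}
    (φ : W → V) (P : ∀ u v : W, H.Adj u v → G.Walk (φ u) (φ v))
    (hφ : Function.Injective φ)
    (h5 : ∀ u v huv, ∀ w ∈ walkInternal (P u v huv), w ∉ Set.range φ)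
    (h6 : ∀ u v huv u' v' huv', s(u, v) ≠ s(u', v') →
      ∀ w ∈ walkInternal (P u v huv), w ∉ walkInternal (P u' v' huv'))
    (u v huv u' v' huv') (e : Sym2 V) (he : e ∈ (P u v huv).edges)
    (he' : e ∈ (P u' v' huv').edges) : s(u, v) = s(u', v') := by
  by_contra hne
  have main : ∀ x, x ∈ (P u v huv).support → x ∈ (P u' v' huv').support →
      (x = φ u ∨ x = φ v) ∧ (x = φ u' ∨ x = φ v') := by
    intro x hx hx'
    have a := aux_mem_support _ hx
    have b := aux_mem_support _ hx'
    have c := h5 u v huv x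
    have d := h5 u' v' huv' x
    have e := h6 u v huv u' v' huv' hne x
    have r : ∀ w, φ w ∈ Set.range φ := fun w => ⟨w, rfl⟩
    grind
  induction e using Sym2.ind with
  | _ x y =>
    have hadj := (P u v huv).adj_of_mem_edges he
    have hxy := hadj.ne
    have a := main x ((P u v huv).fst_mem_support_of_mem_edges he)
      ((P u' v' huv').fst_mem_support_of_mem_edges he')
    have b := main y ((P u v huv).snd_mem_support_of_mem_edges he)
      ((P u' v' huv').snd_mem_support_of_mem_edges he')
    apply hne
    rw [Sym2.eq_iff]
    have i1 := @hφ u u'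
    have i2 := @hφ u v'
    have i3 := @hφ v u'
    have i4 := @hφ v v'
    grind

theorem aux_cross {V : Type*} {G : SimpleGraph V} (X : Set V) {u v : V} (p : G.Walk u v) :
    ∀ (a b : V) (_ : a ∈ p.support) (_ : b ∈ p.support) (_ : a ∈ X) (_ : b ∉ X),
    ∃ x y, x ∈ X ∧ y ∉ X ∧ s(x, y) ∈ p.edges := by
  induction p with
  | nil =>
    intro a b ha hb haX hbX
    simp at ha hb; subst ha; subst hb; exact absurd haX hbX
  | @cons u w v h q ih =>
    intro a b ha hb haX hbX
    simp only [SimpleGraph.Walk.support_cons, List.mem_cons] at ha hb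
    simp only [SimpleGraph.Walk.edges_cons, List.mem_cons]
    have hw : w ∈ q.support := q.start_mem_support
    by_cases huX : u ∈ X <;> by_cases hwX : w ∈ X
    · have hb' : b ∈ q.support := by
        rcases hb with rfl | hb
        · exact absurd huX hbX
        · exact hb
      obtain ⟨x, y, hx, hy, hxy⟩ := ih w b hw hb' hwX hbX
      exact ⟨x, y, hx, hy, Or.inr hxy⟩
    · exact ⟨u, w, huX, hwX, Or.inl rfl⟩
    · exact ⟨w, u, hwX, huX, Or.inl Sym2.eq_swap⟩
    · have ha' : a ∈ q.support := by
        rcases ha with rfl | ha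
        · exact absurd haX huX
        · exact ha
      obtain ⟨x, y, hx, hy, hxy⟩ := ih a w ha' hw haX hwX
      exact ⟨x, y, hx, hy, Or.inr hxy⟩

theorem aux_snd {V : Type*} {G : SimpleGraph V} {u v : V} (p : G.Walk u v)
    (h : 1 ≤ p.length) : s(u, p.snd) ∈ p.edges := by
  cases p with
  | nil => simp at h
  | cons h q => simp

set_option maxHeartbeats 1000000 in
/-- The subdivision of an expander with short paths is an expander. -/
theorem aux_subdiv {W V : Type*} [Fintype W] [Fintype V] {G : SimpleGraph V} {K : SimpleGraph W}
    (φ : W → V) (P : ∀ u v : W, K.Adj u v → G.Walk (φ u) (φ v))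
    (hφ : Function.Injective φ)
    (h3 : ∀ u v huv, 1 ≤ (P u v huv).length)
    (hd : ∀ u v huv u' v' huv' (e : Sym2 V), e ∈ (P u v huv).edges →
      e ∈ (P u' v' huv').edges → s(u, v) = s(u', v'))
    (L : ℕ) (hL : ∀ u v huv, (P u v huv).length ≤ L) (κ : ℝ) (hκ : 0 < κ)
    (hK : IsExpander K κ) (hL0 : 1 ≤ L) :
    ∃ G' : SimpleGraph V, G' ≤ G ∧ nd K ≤ nd G' ∧
      IsExpander G' (1 / (4 * L + 4 * L / κ)) := by
  let G' : SimpleGraph V :=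
    { Adj := fun x y => ∃ u v huv, s(x, y) ∈ (P u v huv).edges
      symm := ⟨by
        rintro x y ⟨u, v, huv, h⟩
        exact ⟨u, v, huv, by rwa [Sym2.eq_swap]⟩⟩
      loopless := ⟨by
        rintro x ⟨u, v, huv, h⟩
        exact G.loopless.irrefl x ((P u v huv).adj_of_mem_edges h)⟩ }
  have hG' : ∀ x y, G'.Adj x y ↔ ∃ u v huv, s(x, y) ∈ (P u v huv).edges := fun _ _ => Iff.rfl
  refine ⟨G', ?_, ?_, ?_⟩
  · rintro x y ⟨u, v, huv, h⟩
    exact (P u v huv).adj_of_mem_edges h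
  · have hsnd : ∀ u v (huv : K.Adj u v), s(φ u, (P u v huv).snd) ∈ (P u v huv).edges := by
      intro u v huv
      exact aux_snd _ (h3 u v huv)
    let g : W × W → V × V := fun p =>
      (φ p.1, if h : K.Adj p.1 p.2 then (P p.1 p.2 h).snd else φ p.1)
    apply card_le_card_of_injOn g
    · rintro ⟨u, v⟩ h
      have h' : K.Adj u v := by simpa using h
      simp only [coe_filter, mem_univ, true_and, Set.mem_ofPred_eq, g, h', dif_pos]
      exact ⟨u, v, h', hsnd u v h'⟩
    · rintro ⟨u, v⟩ h ⟨u', v'⟩ h' heq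
      have h1 : K.Adj u v := by simpa using h
      have h1' : K.Adj u' v' := by simpa using h'
      simp only [g, h1, h1', dif_pos, Prod.mk.injEq] at heq
      obtain ⟨e1, e2⟩ := heq
      have e1 := hφ e1
      subst e1
      have a := hsnd u v h1
      have b := hsnd u v' h1'
      rw [← e2] at b
      have := hd _ _ _ _ _ _ _ a b
      rw [Sym2.eq_iff] at this
      have : v = v' := by grind
      rw [this]
  · intro X
    let bad : Finset (W × W) := univ.filter fun p => ∃ h : K.Adj p.1 p.2,
      (∃ x ∈ (P p.1 p.2 h).support, x ∈ X) ∧ (∃ x ∈ (P p.1 p.2 h).support, x ∉ X)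
    have hbad : #bad ≤ cut G' X * 2 := by
      obtain ⟨T, hT, hTm⟩ : ∃ T : Finset (V × V), cut G' X = #T ∧
          ∀ p, p ∈ T ↔ p.1 ∈ X ∧ p.2 ∉ X ∧ G'.Adj p.1 p.2 :=
        ⟨_, aux_cut G' X, fun p => by simp only [mem_filter, mem_univ, true_and]⟩
      rw [hT]
      let g : V × V → Finset (W × W) := fun q => univ.filter fun p : W × W =>
        ∃ h : K.Adj p.1 p.2, s(q.1, q.2) ∈ (P p.1 p.2 h).edges
      have hgm : ∀ q p, p ∈ g q ↔ ∃ h : K.Adj p.1 p.2, s(q.1, q.2) ∈ (P p.1 p.2 h).edges := by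
        intro q p; simp only [g, mem_filter, mem_univ, true_and]
      clear_value g
      refine le_trans (card_le_card (t := T.biUnion g) ?_)
        (card_biUnion_le_card_mul _ g 2 ?_)
      · rintro ⟨u, v⟩ h
        simp only [bad, mem_filter, mem_univ, true_and] at h
        obtain ⟨h, ⟨a, ha, haX⟩, ⟨b, hb, hbX⟩⟩ := h
        obtain ⟨x, y, hx, hy, hxy⟩ := aux_cross X _ a b ha hb haX hbX
        simp only [mem_biUnion, hTm, hgm]
        exact ⟨(x, y), ⟨hx, hy, u, v, h, hxy⟩, h, hxy⟩
      · rintro ⟨x, y⟩ hq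
        rw [hTm] at hq
        obtain ⟨_, _, u, v, h, hxy⟩ := hq
        refine le_trans (card_le_card ?_) (aux_sym2_fiber s(u, v))
        rintro ⟨u', v'⟩ h'
        simp only [mem_filter, mem_univ, true_and, hgm] at h' ⊢
        obtain ⟨h', hxy'⟩ := h'
        exact hd _ _ _ _ _ _ _ hxy' hxy
    have hcutK : cut K (φ ⁻¹' X) ≤ #bad := by
      rw [aux_cut]
      apply card_le_card
      rintro ⟨u, v⟩ h
      simp only [mem_filter, mem_univ, true_and, Set.mem_preimage, bad] at h ⊢
      exact ⟨h.2.2, ⟨_, SimpleGraph.Walk.start_mem_support _, h.1⟩,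
        ⟨_, SimpleGraph.Walk.end_mem_support _, h.2.1⟩⟩
    have hvol : ∀ Y : Set V, (Y = X ∨ Y = Xᶜ) →
        vol G' Y ≤ (vol K (φ ⁻¹' Y) + #bad) * (L * 2) := by
      intro Y hY
      rw [aux_vol, aux_vol]
      let g : W × W → Finset (V × V) := fun q => univ.filter fun p : V × V =>
        ∃ h : K.Adj q.1 q.2, s(p.1, p.2) ∈ (P q.1 q.2 h).edges
      have hgm : ∀ q p, p ∈ g q ↔ ∃ h : K.Adj q.1 q.2, s(p.1, p.2) ∈ (P q.1 q.2 h).edges := by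
        intro q p; simp only [g, mem_filter, mem_univ, true_and]
      clear_value g
      refine le_trans (card_le_card (t := ((univ.filter
        fun p : W × W => p.1 ∈ φ ⁻¹' Y ∧ K.Adj p.1 p.2) ∪ bad).biUnion g) ?_)
        (le_trans (card_biUnion_le_card_mul _ g (L * 2) ?_)
          (Nat.mul_le_mul_right _ (card_union_le _ _)))
      · rintro ⟨x, y⟩ h
        simp only [mem_filter, mem_univ, true_and] at h
        obtain ⟨hx, u, v, huv, hxy⟩ := h
        simp only [mem_biUnion, mem_filter, mem_univ, true_and, mem_union, Set.mem_preimage, bad, hgm]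
        refine ⟨(u, v), ?_, huv, hxy⟩
        by_cases hu : φ u ∈ Y
        · exact Or.inl ⟨hu, huv⟩
        · right
          refine ⟨huv, ?_⟩
          have a := (P u v huv).start_mem_support
          have b := (P u v huv).fst_mem_support_of_mem_edges hxy
          rcases hY with rfl | rfl
          · exact ⟨⟨x, b, hx⟩, ⟨_, a, hu⟩⟩
          · exact ⟨⟨_, a, by simpa using hu⟩, ⟨x, b, hx⟩⟩
      · rintro ⟨u, v⟩ hq
        have huv : K.Adj u v := by
          simp only [mem_filter, mem_univ, true_and, mem_union, bad] at hq
          rcases hq with h | ⟨h, _⟩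
          · exact h.2
          · exact h
        have hc : #((P u v huv).edges.toFinset) ≤ L := by
          refine le_trans (List.toFinset_card_le _) ?_
          rw [SimpleGraph.Walk.length_edges]
          exact hL u v huv
        refine le_trans (card_le_card (t := ((P u v huv).edges.toFinset).biUnion
          (fun e => univ.filter fun p : V × V => s(p.1, p.2) = e)) ?_)
          (le_trans (card_biUnion_le_card_mul _ _ 2 (fun e _ => aux_sym2_fiber e))
            (Nat.mul_le_mul_right _ hc))
        rintro ⟨x, y⟩ h
        rw [hgm] at h
        obtain ⟨_, h⟩ := h
        simp only [mem_biUnion, List.mem_toFinset, mem_filter, mem_univ, true_and]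
        exact ⟨_, h, rfl⟩
    have hb : (#bad : ℝ) ≤ cut G' X * 2 := by exact_mod_cast hbad
    have hcK : (cut K (φ ⁻¹' X) : ℝ) ≤ #bad := by exact_mod_cast hcutK
    have hv1 : (vol G' X : ℝ) ≤ (vol K (φ ⁻¹' X) + #bad) * (L * 2) := by
      exact_mod_cast hvol X (Or.inl rfl)
    have hv2 : (vol G' Xᶜ : ℝ) ≤ (vol K (φ ⁻¹' X)ᶜ + #bad) * (L * 2) := by
      exact_mod_cast hvol Xᶜ (Or.inr rfl)
    have hexp := hK (φ ⁻¹' X)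
    have hLr : (1 : ℝ) ≤ L := by exact_mod_cast hL0
    have hm : min (vol G' X : ℝ) (vol G' Xᶜ) ≤
        (min (vol K (φ ⁻¹' X) : ℝ) (vol K (φ ⁻¹' X)ᶜ) + #bad) * (L * 2) := by
      rcases le_total (vol K (φ ⁻¹' X) : ℝ) (vol K (φ ⁻¹' X)ᶜ) with h | h
      · rw [min_eq_left h]; exact le_trans (min_le_left _ _) hv1
      · rw [min_eq_right h]; exact le_trans (min_le_right _ _) hv2
    have hm2 : min (vol K (φ ⁻¹' X) : ℝ) (vol K (φ ⁻¹' X)ᶜ) ≤ cut G' X * 2 / κ := by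
      rw [le_div_iff₀ hκ]; linarith
    rw [one_div, inv_mul_le_iff₀ (by positivity)]
    refine le_trans hm ?_
    have : (min (vol K (φ ⁻¹' X) : ℝ) (vol K (φ ⁻¹' X)ᶜ) + #bad) * (L * 2) ≤
      (cut G' X * 2 / κ + cut G' X * 2) * (L * 2) := by
      apply mul_le_mul_of_nonneg_right _ (by positivity)
      linarith
    refine le_trans this (le_of_eq ?_)
    ring

/-- Few paths are long. -/
theorem aux_long {W V : Type*} [Fintype W] [Fintype V] {G : SimpleGraph V} {H : SimpleGraph W}
    (φ : W → V) (P : ∀ u v : W, H.Adj u v → G.Walk (φ u) (φ v))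
    (h2 : ∀ u v huv, (P u v huv).IsPath)
    (hd : ∀ u v huv u' v' huv' (e : Sym2 V), e ∈ (P u v huv).edges →
      e ∈ (P u' v' huv').edges → s(u, v) = s(u', v'))
    (L : ℕ) :
    #(univ.filter fun p : W × W => ∃ h : H.Adj p.1 p.2, L < (P p.1 p.2 h).length) * L
      ≤ edgeCount G * 2 := by
  have hE : edgeCount G = #G.edgeFinset := by
    unfold edgeCount
    rw [Nat.card_eq_fintype_card, ← SimpleGraph.edgeFinset_card]
  rw [hE]
  apply card_mul_le_card_mul (fun (p : W × W) (e : Sym2 V) =>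
    ∃ h : H.Adj p.1 p.2, e ∈ (P p.1 p.2 h).edges)
  · rintro ⟨u, v⟩ h
    simp only [mem_filter, mem_univ, true_and] at h
    obtain ⟨huv, hl⟩ := h
    have : #((P u v huv).edges.toFinset) = (P u v huv).length := by
      rw [List.toFinset_card_of_nodup (h2 u v huv).isTrail.edges_nodup,
        SimpleGraph.Walk.length_edges]
    refine le_trans (le_trans hl.le this.ge) (card_le_card ?_)
    intro e he
    rw [List.mem_toFinset] at he
    simp only [mem_bipartiteAbove, SimpleGraph.mem_edgeFinset]
    exact ⟨(P u v huv).edges_subset_edgeSet he, huv, he⟩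
  · intro e he
    by_cases hex : ∃ u v, ∃ huv : H.Adj u v, e ∈ (P u v huv).edges
    · obtain ⟨u, v, huv, h⟩ := hex
      refine le_trans (card_le_card ?_) (aux_sym2_fiber s(u, v))
      rintro ⟨u', v'⟩ h'
      simp only [mem_bipartiteBelow, mem_filter, mem_univ, true_and] at h' ⊢
      obtain ⟨_, _, h'⟩ := h'
      exact hd _ _ _ _ _ _ _ h' h
    · refine le_trans (le_of_eq (card_eq_zero.mpr ?_)) (Nat.zero_le 2)
      rw [eq_empty_iff_forall_notMem]
      rintro ⟨u', v'⟩ h'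
      simp only [mem_bipartiteBelow] at h'
      obtain ⟨_, h, h'⟩ := h'
      exact hex ⟨_, _, h, h'⟩

theorem aux_induce {V : Type*} [Fintype V] (G : SimpleGraph V) (S : Set V) (G' : SimpleGraph S)
    (h : G' ≤ G.induce S) : edgeCount G' ≤ edgeCount G := by
  have : nd G' ≤ nd G := by
    apply card_le_card_of_injOn (fun p => (p.1.1, p.2.1))
    · rintro ⟨a, b⟩ hab
      simp at hab ⊢
      exact h hab
    · rintro ⟨a, b⟩ _ ⟨c, d⟩ _ heq
      simp at heq
      rw [Subtype.ext heq.1, Subtype.ext heq.2]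
  rw [aux_nd, aux_nd] at this
  omega

theorem aux_mono {V : Type*} (G : SimpleGraph V) (κ κ' : ℝ) (h : κ' ≤ κ)
    (hG : IsExpander G κ) : IsExpander G κ' := by
  intro X
  refine le_trans (mul_le_mul_of_nonneg_right h ?_) (hG X)
  exact le_min (Nat.cast_nonneg _) (Nat.cast_nonneg _)

end Helpers

/-- For all `κ, α > 0` and `0 < α' < α` there exists `κ' > 0` such that:
for every finite graph `G`, if some finite graph `H` with `e(H) ≥ α·e(G)` is a topological
minor of `G` and a `κ`-expander, then some subgraph `H*` of `G` (a graph on a vertex subset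
`S` whose edges are among those of `G.induce S`) satisfies `e(H*) ≥ α'·e(G)` and is a
`κ'`-expander. -/
theorem topMinor_expander_to_subgraph_expander
    (κ α α' : ℝ) (hκ : 0 < κ) (hα : 0 < α) (hα'0 : 0 < α') (hα' : α' < α) :
    ∃ κ' : ℝ, 0 < κ' ∧
      ∀ (V : Type u) [Fintype V] (G : SimpleGraph V),
        (∃ (W : Type u) (_ : Fintype W) (H : SimpleGraph W),
          α * (edgeCount G : ℝ) ≤ (edgeCount H : ℝ) ∧
          IsTopologicalMinor H G ∧
          IsExpander H κ) →
        ∃ (S : Set V) (Hstar : SimpleGraph S),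
          Hstar ≤ G.induce S ∧
          α' * (edgeCount G : ℝ) ≤ (edgeCount Hstar : ℝ) ∧
          IsExpander Hstar κ' := by
  set k := min κ 1 with hk
  have hk0 : 0 < k := lt_min hκ one_pos
  have hk1 : k ≤ 1 := min_le_right _ _
  have hαα : 0 < α - α' := sub_pos.mpr hα'
  obtain ⟨L, hL⟩ := exists_nat_ge (max 1 (max (12 / (α * k)) (5 / (k * (α - α')))))
  have hL1 : (1 : ℝ) ≤ L := le_trans (le_max_left _ _) hL
  have hL2 : 12 / (α * k) ≤ L :=
    le_trans (le_trans (le_max_left _ _) (le_max_right _ _)) hL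
  have hL3 : 5 / (k * (α - α')) ≤ L :=
    le_trans (le_trans (le_max_right _ _) (le_max_right _ _)) hL
  have hLn : 1 ≤ L := by exact_mod_cast hL1
  rw [div_le_iff₀ (by positivity)] at hL2 hL3
  refine ⟨1 / (4 * L + 4 * L / (k / 4)), by positivity, ?_⟩
  classical
  rintro V _ G ⟨W, _, H, hHG, ⟨S, G', hG', φ, P, hφ, h2, h3, h4, h5, h6, -, -⟩, hexp⟩
  have hd := aux_disj φ P hφ h5 h6
  have hexp' := aux_mono H κ k (min_le_left _ _) hexp
  let H' : SimpleGraph W :=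
    { Adj := fun u v => ∃ h : H.Adj u v, (P u v h).length ≤ L
      symm := ⟨by
        rintro u v ⟨h, hl⟩
        refine ⟨h.symm, ?_⟩
        rw [h4 u v h, SimpleGraph.Walk.length_reverse]
        exact hl⟩
      loopless := ⟨fun u h => H.loopless.irrefl u h.1⟩ }
  have hle : H' ≤ H := fun u v h => h.1
  have hlong := aux_long φ P h2 hd L
  have hind := aux_induce G S G' hG'
  set f : ℕ := Finset.card (Finset.univ.filter
    fun p : W × W => ∃ h : H.Adj p.1 p.2, L < (P p.1 p.2 h).length) with hfdef
  have hlong' : (f : ℝ) * L ≤ edgeCount G' * 2 := by exact_mod_cast hlong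
  have hind' : (edgeCount G' : ℝ) ≤ edgeCount G := by exact_mod_cast hind
  have hnd : (nd H : ℝ) = 2 * edgeCount H := by exact_mod_cast aux_nd H
  have hfL : α * ((f : ℝ) * L) ≤ nd H := by
    have : α * ((f : ℝ) * L) ≤ α * (edgeCount G * 2) :=
      mul_le_mul_of_nonneg_left (by linarith) hα.le
    linarith
  have hf0 : (0 : ℝ) ≤ f := Nat.cast_nonneg _
  have hfN : (f : ℝ) ≤ k * nd H / 12 := by
    have a : (f : ℝ) * 12 ≤ f * (L * (α * k)) := mul_le_mul_of_nonneg_left hL2 hf0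
    have b : k * (α * ((f : ℝ) * L)) ≤ k * nd H := mul_le_mul_of_nonneg_left hfL hk0.le
    linarith
  obtain ⟨K, hKH', hKexp, hKnd⟩ := aux_prune H H' k f hk0 hk1 hexp' hle (by
    refine Nat.cast_le.mpr (Finset.card_le_card ?_)
    rintro ⟨u, v⟩ h
    simp only [Finset.mem_filter, Finset.mem_univ, true_and] at h ⊢
    refine ⟨h.1, ?_⟩
    by_contra hc
    exact h.2 ⟨h.1, not_lt.mp hc⟩) hfN
  obtain ⟨Gs, hGs, hcard, hGexp⟩ := aux_subdiv (G := G') (K := K) φ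
    (fun u v h => P u v (hle (hKH' h))) hφ (fun u v h => h3 u v _)
    (fun u v h u' v' h' e he he' => hd u v _ u' v' _ e he he') L
    (fun u v h => (hKH' h).2) (k / 4) (by positivity) hKexp hLn
  refine ⟨S, Gs, le_trans hGs hG', ?_, hGexp⟩
  have e1 : (nd K : ℝ) ≤ 2 * edgeCount Gs := by
    rw [aux_nd] at hcard
    rw [aux_nd] at hcard ⊢
    exact_mod_cast hcard
  have e2 : 5 * (f : ℝ) / k * α ≤ (α - α') * nd H := by
    rw [div_mul_eq_mul_div, div_le_iff₀ hk0]
    have a : (f * α) * 5 ≤ (f * α) * (L * (k * (α - α'))) :=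
      mul_le_mul_of_nonneg_left hL3 (by positivity)
    have b : (k * (α - α')) * (α * ((f : ℝ) * L)) ≤ (k * (α - α')) * nd H :=
      mul_le_mul_of_nonneg_left hfL (by positivity)
    linarith
  have e3 : α * (nd H - 5 * f / k) ≤ α * (2 * edgeCount Gs) :=
    mul_le_mul_of_nonneg_left (by linarith) hα.le
  have e4 : α' * (α * edgeCount G) ≤ α' * edgeCount H := mul_le_mul_of_nonneg_left hHG hα'0.le
  have e5 : α * (α' * edgeCount G) ≤ α * edgeCount Gs := by
    rw [hnd] at e2 e3
    linarith
  exact le_of_mul_le_mul_left e5 hα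
end

section
/- For all κ, α > 0 and all 0 < α' < α, there exists κ' > 0 such that the following holds for every finite graph G. If there exists a graph H such that e(H) ≥ α·e(G), H is a subgraph of G, and H is a κ-expander, then there exists a graph H* such that e(H*) ≥ α'·e(G), H* is an induced subgraph of G, and H* is a κ'-expander. -/
universe u

/-- Number of ordered adjacent pairs in `A × B`. -/
noncomputable def pairN {V : Type*} (G : SimpleGraph V) (A B : Set V) : ℝ :=
  (({p : V × V | p.1 ∈ A ∧ p.2 ∈ B ∧ G.Adj p.1 p.2}).ncard : ℝ)

section pairs
variable {V : Type*} [Finite V]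

lemma pairN_nonneg (G : SimpleGraph V) (A B : Set V) : 0 ≤ pairN G A B := by
  unfold pairN; positivity

lemma pairN_mono {G G' : SimpleGraph V} (h : G ≤ G') {A A' B B' : Set V} (hA : A ⊆ A')
    (hB : B ⊆ B') : pairN G A B ≤ pairN G' A' B' := by
  unfold pairN
  have := Set.toFinite {p : V × V | p.1 ∈ A' ∧ p.2 ∈ B' ∧ G'.Adj p.1 p.2}
  have hs : {p : V × V | p.1 ∈ A ∧ p.2 ∈ B ∧ G.Adj p.1 p.2} ⊆
      {p : V × V | p.1 ∈ A' ∧ p.2 ∈ B' ∧ G'.Adj p.1 p.2} :=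
    fun p hp => ⟨hA hp.1, hB hp.2.1, h hp.2.2⟩
  exact_mod_cast Set.ncard_le_ncard hs this

lemma pairN_comm (G : SimpleGraph V) (A B : Set V) : pairN G A B = pairN G B A := by
  unfold pairN
  rw [← Set.ncard_image_of_injective _ (Prod.swap_injective (α := V) (β := V))]
  congr 2
  ext ⟨x, y⟩
  simp [Set.mem_image, G.adj_comm]
  tauto

lemma pairN_union_left (G : SimpleGraph V) {A A' : Set V} (B : Set V) (h : Disjoint A A') :
    pairN G (A ∪ A') B = pairN G A B + pairN G A' B := by
  unfold pairN
  rw [← Nat.cast_add, ← Set.ncard_union_eq _ (Set.toFinite _) (Set.toFinite _)]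
  · congr 2
    ext p
    simp
    tauto
  · rw [Set.disjoint_left]
    intro p hp hp'
    exact Set.disjoint_left.1 h hp.1 hp'.1

lemma pairN_union_right (G : SimpleGraph V) {A A' : Set V} (B : Set V) (h : Disjoint A A') :
    pairN G B (A ∪ A') = pairN G B A + pairN G B A' := by
  rw [pairN_comm, pairN_union_left G B h, pairN_comm G A, pairN_comm G A']

lemma cut_eq_pairN (G : SimpleGraph V) (X : Set V) : (cut G X : ℝ) = pairN G X Xᶜ := rfl

lemma vdeg_eq_pairN (G : SimpleGraph V) (v : V) : (vdeg G v : ℝ) = pairN G {v} Set.univ := by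
  unfold pairN vdeg
  rw [Nat.card_coe_set_eq, ← Set.ncard_image_of_injective _ (Prod.mk_right_injective v)]
  congr 2
  ext ⟨x, y⟩
  simp
  grind

lemma vol_eq_pairN (G : SimpleGraph V) (X : Set V) : (vol G X : ℝ) = pairN G X Set.univ := by
  induction X, Set.toFinite X using Set.Finite.induction_on with
  | empty => simp [vol, pairN]
  | @insert a s ha hs ih =>
    rw [Set.insert_eq, pairN_union_left G _ (by simpa using ha), ← ih, ← vdeg_eq_pairN,
      ← Set.insert_eq]
    unfold vol
    rw [finsum_mem_insert _ ha hs]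
    push_cast
    rfl

lemma edgeCount_eq_pairN (G : SimpleGraph V) :
    2 * (edgeCount G : ℝ) = pairN G Set.univ Set.univ := by
  classical
  have := Fintype.ofFinite V
  have h := G.dart_card_eq_twice_card_edges
  have h1 : edgeCount G = G.edgeFinset.card := by
    unfold edgeCount
    rw [Nat.card_eq_fintype_card, SimpleGraph.edgeFinset_card]
  rw [h1]
  unfold pairN
  have h2 : {p : V × V | p.1 ∈ Set.univ ∧ p.2 ∈ Set.univ ∧ G.Adj p.1 p.2}.ncard
      = Fintype.card G.Dart := by
    rw [← Nat.card_coe_set_eq, ← Nat.card_eq_fintype_card]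
    refine Nat.card_congr ⟨fun p => ⟨p.1, p.2.2.2⟩, fun d => ⟨d.toProd, trivial, trivial, d.adj⟩,
      fun _ => rfl, fun _ => rfl⟩
  rw [h2, h]
  push_cast
  rfl

lemma pairN_comap {W : Type*} (f : W ↪ V) (G : SimpleGraph V) (A B : Set W) :
    pairN (G.comap f) A B = pairN G (f '' A) (f '' B) := by
  unfold pairN
  rw [← Set.ncard_image_of_injective _ (f.injective.prodMap f.injective)]
  congr 2
  ext ⟨x, y⟩
  simp
  grind

lemma core (κ α α' ε m : ℝ) (hκ : 0 < κ) (hε : 0 < ε) (h3 : 3 * ε < 2 * α)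
    (hεα : ε ≤ α - α') (g h : SimpleGraph V) (hle : h ≤ g) (S : Set V)
    (hm : pairN g S S ≤ 2 * m) (hS : 2 * α * m ≤ pairN h S S)
    (hexp : ∀ X ⊆ S, κ * min (pairN h X S) (pairN h (S \ X) S) ≤ pairN h X (S \ X)) :
    ∃ T : Set V, 2 * α' * m ≤ pairN g T T ∧ ∀ X ⊆ T,
      κ * ε / 2 * min (pairN g X T) (pairN g (T \ X) T) ≤ pairN g X (T \ X) := by
  have hm0 : 0 ≤ m := by linarith [pairN_nonneg g S S]
  set k := κ * ε / 2 with hk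
  have hk0 : 0 < k := by positivity
  let good : Set (Set V) := {T | T ⊆ S ∧ pairN g T (S \ T) ≤ k * (pairN g S S - pairN g T T) ∧
    pairN h (S \ T) S ≤ ε * m}
  obtain ⟨T, ⟨hTS, hT1, hT2⟩, hmin⟩ := (Set.toFinite good).exists_minimal
    ⟨S, subset_rfl, by simp [pairN], by
      have : 0 ≤ ε * m := by positivity
      simpa [pairN] using this⟩
  have hST : (S \ T) ∪ T = S := Set.diff_union_of_subset hTS
  have hdST : Disjoint (S \ T) T := Set.disjoint_sdiff_left
  have hsplit : pairN h S S = pairN h (S \ T) S + pairN h T S := by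
    rw [← pairN_union_left h S hdST, hST]
  refine ⟨T, ?_, ?_⟩
  · have h1 : pairN h T S = pairN h T (S \ T) + pairN h T T := by
      rw [← pairN_union_right h T hdST, hST]
    have h2 : pairN h T (S \ T) ≤ pairN h (S \ T) S := by
      rw [pairN_comm]; exact pairN_mono le_rfl subset_rfl hTS
    have h4 : pairN h T T ≤ pairN g T T := pairN_mono hle subset_rfl subset_rfl
    have : ε * m ≤ (α - α') * m := mul_le_mul_of_nonneg_right hεα hm0
    nlinarith
  -- one-sided claim
  have key : ∀ X ⊆ T, pairN h X S ≤ pairN h (T \ X) S →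
      k * min (pairN g X T) (pairN g (T \ X) T) ≤ pairN g X (T \ X) := by
    intro X hX hXY
    by_contra hcon
    push Not at hcon
    have hlt : pairN g X (T \ X) < k * pairN g X T :=
      hcon.trans_le (mul_le_mul_of_nonneg_left (min_le_left _ _) hk0.le)
    set Y := T \ X with hY
    have hXYT : X ∪ Y = T := Set.union_diff_cancel hX
    have hdXY : Disjoint X Y := Set.disjoint_sdiff_right
    have hYT : Y ⊆ T := Set.diff_subset
    have hYS : Y ⊆ S := hYT.trans hTS
    have hR : S \ Y = (S \ T) ∪ X := by
      ext v; have := @hX v; have := @hTS v; simp [hY]; tauto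
    have hdRX : Disjoint (S \ T) X := hdST.mono_right hX
    have hRY : S \ (S \ Y) = Y := Set.sdiff_sdiff_cancel_left hYS
    have hgX : 0 < pairN g X T := by
      have := pairN_nonneg g X Y
      by_contra hc
      nlinarith
    have hgTT : pairN g T T = pairN g X T + pairN g Y X + pairN g Y Y := by
      have e1 : pairN g T T = pairN g X T + pairN g Y T := by
        rw [← pairN_union_left g T hdXY, hXYT]
      have e2 : pairN g Y T = pairN g Y X + pairN g Y Y := by
        rw [← pairN_union_right g Y hdXY, hXYT]
      linarith
    have hgTS : pairN g T T ≤ pairN g S S := pairN_mono le_rfl hTS hTS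
    have hmpos : 0 < m := by
      linarith [pairN_nonneg g Y X, pairN_nonneg g Y Y]
    have hcut : pairN g Y (S \ Y) ≤ k * (pairN g S S - pairN g Y Y) := by
      rw [hR, pairN_union_right g Y hdRX]
      have e1 : pairN g Y (S \ T) ≤ pairN g T (S \ T) := pairN_mono le_rfl hYT subset_rfl
      have e2 := pairN_comm g X Y
      have e3 : 0 ≤ k * pairN g Y X := mul_nonneg hk0.le (pairN_nonneg _ _ _)
      rw [hgTT] at hT1
      nlinarith
    have hcut2 : pairN h (S \ Y) Y ≤ κ * (ε * m) := by
      have e1 : pairN h (S \ Y) Y ≤ pairN g Y (S \ Y) := by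
        rw [pairN_comm]; exact pairN_mono hle subset_rfl subset_rfl
      have e2 : k * (pairN g S S - pairN g Y Y) ≤ k * (2 * m) :=
        mul_le_mul_of_nonneg_left (by linarith [pairN_nonneg g Y Y]) hk0.le
      have e3 : k * (2 * m) = κ * (ε * m) := by rw [hk]; ring
      linarith
    have hex := hexp (S \ Y) Set.diff_subset
    rw [hRY] at hex
    have hmn : min (pairN h (S \ Y) S) (pairN h Y S) ≤ ε * m :=
      le_of_mul_le_mul_left (hex.trans hcut2) hκ
    have hTsplit : pairN h T S = pairN h X S + pairN h Y S := by
      rw [← pairN_union_left h S hdXY, hXYT]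
    have hbig : ε * m < pairN h Y S := by
      have : 3 * ε * m < 2 * α * m := mul_lt_mul_of_pos_right h3 hmpos
      linarith
    have hgood : pairN h (S \ Y) S ≤ ε * m := by
      rcases min_le_iff.1 hmn with h | h
      · exact h
      · linarith
    have hTY : T ⊆ Y := hmin (y := Y) ⟨hYS, hcut, hgood⟩ hYT
    have hX0 : X = ∅ := by
      ext v
      have := @hX v; have := @hTY v
      simp [hY] at *
      tauto
    rw [hX0] at hgX
    simp [pairN] at hgX
  intro X hX
  rcases le_total (pairN h X S) (pairN h (T \ X) S) with h1 | h1
  · exact key X hX h1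
  · have hTX : T \ (T \ X) = X := Set.sdiff_sdiff_cancel_left hX
    have := key (T \ X) Set.diff_subset (by rwa [hTX])
    rwa [hTX, min_comm, pairN_comm g (T \ X) X] at this

end pairs

/-- For all `κ, α > 0` and `0 < α' < α` there exists `κ' > 0` such that:
for every finite graph `G`, if some subgraph `H` of `G` (a graph on a vertex subset `S` whose
edges are among those of `G.induce S`) satisfies `e(H) ≥ α·e(G)` and is a `κ`-expander, then
some induced subgraph `H* = G.induce T` of `G` satisfies `e(H*) ≥ α'·e(G)` and is a
`κ'`-expander. -/
theorem subgraph_expander_to_induced_expander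
    (κ α α' : ℝ) (hκ : 0 < κ) (hα : 0 < α) (hα'0 : 0 < α') (hα' : α' < α) :
    ∃ κ' : ℝ, 0 < κ' ∧
      ∀ (V : Type u) [Fintype V] (G : SimpleGraph V),
        (∃ (S : Set V) (H : SimpleGraph S),
          H ≤ G.induce S ∧
          α * (edgeCount G : ℝ) ≤ (edgeCount H : ℝ) ∧
          IsExpander H κ) →
        ∃ T : Set V,
          α' * (edgeCount G : ℝ) ≤ (edgeCount (G.induce T) : ℝ) ∧
          IsExpander (G.induce T) κ' := by
  have hd : 0 < α - α' := sub_pos.2 hα'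
  refine ⟨κ * ((α - α') / 2) / 2, by positivity, ?_⟩
  rintro V _ G ⟨S, H, hHG, hH, hexp⟩
  set f : S ↪ V := Function.Embedding.subtype (· ∈ S) with hf
  have hcm : (H.map f).comap f = H := SimpleGraph.comap_map_eq f H
  have hle : H.map f ≤ G := by
    rw [SimpleGraph.map_le_iff_le_comap]; exact hHG
  have hfu : ∀ T : Set V, (Function.Embedding.subtype (· ∈ T)) '' Set.univ = T := by
    intro T; simp
  have hfc : ∀ (T : Set V) (X : Set T), (Function.Embedding.subtype (· ∈ T)) '' Xᶜ
      = T \ ((Function.Embedding.subtype (· ∈ T)) '' X) := by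
    intro T X
    ext v; simp
  have hN : ∀ A B, pairN H A B = pairN (H.map f) (f '' A) (f '' B) := by
    intro A B
    rw [← pairN_comap, hcm]
  obtain ⟨T, hT1, hT2⟩ := core κ α α' ((α - α') / 2) (edgeCount G) hκ (by positivity)
    (by linarith) (by linarith) G (H.map f) hle S
    (by rw [edgeCount_eq_pairN]; exact pairN_mono le_rfl (Set.subset_univ _) (Set.subset_univ _))
    (by
      have := edgeCount_eq_pairN H
      rw [hN, hf, hfu] at this
      rw [← hf] at this
      linarith)
    (by
      intro X hX
      have := hexp (f ⁻¹' X)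
      have hXi : f '' (f ⁻¹' X) = X := by
        rw [Set.image_preimage_eq_iff]; simpa [hf] using hX
      rw [cut_eq_pairN, vol_eq_pairN, vol_eq_pairN, hN, hN, hN, hfc, hfu, ← hf, hXi] at this
      exact this)
  have hN' : ∀ A B, pairN (G.induce T) A B = pairN G ((Function.Embedding.subtype (· ∈ T)) '' A)
      ((Function.Embedding.subtype (· ∈ T)) '' B) := fun A B => pairN_comap _ G A B
  refine ⟨T, ?_, ?_⟩
  · have := edgeCount_eq_pairN (G.induce T)
    rw [hN', hfu] at this
    linarith
  · intro X
    rw [cut_eq_pairN, vol_eq_pairN, vol_eq_pairN, hN', hN', hN', hfc, hfu]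
    exact hT2 _ (by simp)
end
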